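/- Let G be the group with generators e_0, e_1, e_2, e_3, generators y_{i,1}, y_{i,2} for i ∈ {0,1,2,3}, and generators y_{ij,1}, y_{ij,2}, y_{ij,3} for (i,j) ∈ {(0,1), (0,2), (1,3), (2,3)}; write y_i := [y_{i,1}, y_{i,2}] and y_{ij} := [[y_{ij,1}, y_{ij,2}], y_{ij,3}]; the relations are e_i^{3^{2i}} = y_i for i ∈ {0,1,2,3} and e_j^{3^{12−i}}·e_i^{3^{12−j}} = y_{ij}^{3^{12−2i−2j}} for (i,j) ∈ {(0,1), (0,2), (1,3), (2,3)} (i.e. G is the quotient of the free group on all listed generators by the normal closure of the corresponding relators). Then the element ω := [[e_2, e_1], e_0]^{3⁹} does not belong to γ_7(G), but its cube ω³ does belong to γ_7(G). -/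

import Mathlib

open scoped commutatorElement

/-- `γ_n(G)`, the `n`-th term of the lower central series, with `γ_1(G) = G`. -/
def gammaGrp (G : Type*) [Group G] (n : ℕ) : Subgroup G := Subgroup.lowerCentralSeries (⊤ : Subgroup G) (n - 1)

/-- The four index pairs `(0,1), (0,2), (1,3), (2,3)`. -/
def pairIdx : Fin 4 → Fin 4 × Fin 4 := ![(0, 1), (0, 2), (1, 3), (2, 3)]

/-- The generating set: `e_0, …, e_3`; `y_{i,1}, y_{i,2}` for `i ∈ Fin 4`; and
`y_{ij,1}, y_{ij,2}, y_{ij,3}` for the four pairs `(i,j)`. -/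
abbrev TGen : Type := Fin 4 ⊕ (Fin 4 × Fin 2) ⊕ (Fin 4 × Fin 3)

/-- The free generators `e_i`. -/
def eF (i : Fin 4) : FreeGroup TGen := FreeGroup.of (Sum.inl i)

/-- `y_i := [y_{i,1}, y_{i,2}]`. -/
def yF (i : Fin 4) : FreeGroup TGen :=
  ⁅FreeGroup.of ((Sum.inr (Sum.inl (i, 0)) : TGen)),
   FreeGroup.of ((Sum.inr (Sum.inl (i, 1)) : TGen))⁆

/-- `y_{ij} := [[y_{ij,1}, y_{ij,2}], y_{ij,3}]` for the `k`-th pair `(i,j)`. -/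
def yyF (k : Fin 4) : FreeGroup TGen :=
  ⁅⁅FreeGroup.of ((Sum.inr (Sum.inr (k, 0)) : TGen)),
    FreeGroup.of ((Sum.inr (Sum.inr (k, 1)) : TGen))⁆,
   FreeGroup.of ((Sum.inr (Sum.inr (k, 2)) : TGen))⁆

/-- The relators `e_i^{3^{2i}}·y_i⁻¹` and
`e_j^{3^{12-i}}·e_i^{3^{12-j}}·(y_{ij}^{3^{12-2i-2j}})⁻¹`. -/
def tRels : Set (FreeGroup TGen) :=
  {w | ∃ i : Fin 4, w = eF i ^ (3 ^ (2 * (i : ℕ))) * (yF i)⁻¹} ∪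
  {w | ∃ k : Fin 4, w =
    eF (pairIdx k).2 ^ (3 ^ (12 - ((pairIdx k).1 : ℕ)))
      * eF (pairIdx k).1 ^ (3 ^ (12 - ((pairIdx k).2 : ℕ)))
      * (yyF k ^ (3 ^ (12 - 2 * ((pairIdx k).1 : ℕ) - 2 * ((pairIdx k).2 : ℕ))))⁻¹}

/-- The group `G` presented by the above generators and relators. -/
def TGrp : Type := PresentedGroup tRels

instance : Group TGrp := inferInstanceAs (Group (PresentedGroup tRels))

/-- The images `e_i` of the generators in `G`. -/
def eT (i : Fin 4) : TGrp := PresentedGroup.of (Sum.inl i)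


section Leib

variable {Γ : Type*} [Group Γ]

/-- truncated polynomial filtration -/
def leibQ (s : Γ) (B : ℕ → Subgroup Γ) : ℕ → ℕ → Set Γ
  | 0, k => {g | g ∈ B k}
  | r + 1, k => {g | g ∈ B k ∧ ⁅s, g⁆ ∈ leibQ s B r (k + 1)}

variable {s : Γ} {B : ℕ → Subgroup Γ}

theorem leibQ_zero {k : ℕ} {g : Γ} : g ∈ leibQ s B 0 k ↔ g ∈ B k := Iff.rfl

theorem leibQ_succ {r k : ℕ} {g : Γ} :
    g ∈ leibQ s B (r + 1) k ↔ g ∈ B k ∧ ⁅s, g⁆ ∈ leibQ s B r (k + 1) := Iff.rfl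

theorem leibQ_B {r k : ℕ} {g : Γ} (h : g ∈ leibQ s B r k) : g ∈ B k := by
  cases r with
  | zero => exact h
  | succ r => exact h.1

theorem leibQ_down (r : ℕ) : ∀ {k : ℕ} {g : Γ}, g ∈ leibQ s B (r + 1) k → g ∈ leibQ s B r k := by
  induction r with
  | zero => intro k g h; exact h.1
  | succ r ih => intro k g h; exact ⟨h.1, ih h.2⟩

theorem leibQ_anti (hA : Antitone B) (r : ℕ) :
    ∀ {k l : ℕ} {g : Γ}, k ≤ l → g ∈ leibQ s B r l → g ∈ leibQ s B r k := by
  induction r with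
  | zero => intro k l g hkl h; exact hA hkl h
  | succ r ih => intro k l g hkl h; exact ⟨hA hkl h.1, ih (by omega) h.2⟩

theorem leibQ_main (hA : Antitone B)
    (hB : ∀ i j x y, x ∈ B i → y ∈ B j → ⁅x, y⁆ ∈ B (i + j)) (r : ℕ) :
    (∀ k, (1 : Γ) ∈ leibQ s B r k) ∧
    (∀ k g h, g ∈ leibQ s B r k → h ∈ leibQ s B r k → g * h ∈ leibQ s B r k) ∧
    (∀ k g, g ∈ leibQ s B r k → g⁻¹ ∈ leibQ s B r k) ∧
    (∀ k l g h, g ∈ leibQ s B r k → h ∈ leibQ s B r l → ⁅g, h⁆ ∈ leibQ s B r (k + l)) := by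
  induction r with
  | zero =>
    exact ⟨fun k => (B k).one_mem, fun k g h => (B k).mul_mem, fun k g => (B k).inv_mem,
      fun k l g h => hB k l g h⟩
  | succ r ih =>
    obtain ⟨i1, im, ii, ic⟩ := ih
    refine ⟨fun k => ⟨(B k).one_mem, ?_⟩, fun k g h hg hh => ⟨(B k).mul_mem hg.1 hh.1, ?_⟩,
      fun k g hg => ⟨(B k).inv_mem hg.1, ?_⟩, fun k l g h hg hh => ⟨hB k l g h hg.1 hh.1, ?_⟩⟩
    · rw [commutatorElement_one_right]; exact i1 _
    · have e : ⁅s, g * h⁆ = ⁅s, g⁆ * (⁅g, ⁅s, h⁆⁆ * ⁅s, h⁆) := by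
        simp only [commutatorElement_def]; group
      rw [e]
      refine im _ _ _ hg.2 (im _ _ _ ?_ hh.2)
      exact leibQ_anti hA r (by omega) (ic _ _ _ _ (leibQ_down r hg) hh.2)
    · have e : ⁅s, g⁻¹⁆ = ⁅g⁻¹, ⁅s, g⁆⁻¹⁆ * ⁅s, g⁆⁻¹ := by
        simp only [commutatorElement_def]; group
      rw [e]
      refine im _ _ _ ?_ (ii _ _ hg.2)
      exact leibQ_anti hA r (by omega) (ic _ _ _ _ (ii _ _ (leibQ_down r hg)) (ii _ _ hg.2))
    · have hg' := leibQ_down r hg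
      have hh' := leibQ_down r hh
      have hc := ic _ _ _ _ hg' hh'
      have e : ⁅s, ⁅g, h⁆⁆ =
          ⁅⁅s, g⁆, ⁅g, ⁅s, h⁆ * h⁆⁆ * (⁅g, ⁅s, h⁆⁆ * (⁅⁅s, h⁆, ⁅g, h⁆⁆ * (⁅g, h⁆ *
            (⁅⁅s, g⁆, ⁅s, h⁆⁆ * (⁅⁅s, h⁆, ⁅⁅s, g⁆, h⁆⁆ * ⁅⁅s, g⁆, h⁆)) * ⁅g, h⁆⁻¹))) := by
        simp only [commutatorElement_def]; group
      have hsh : ⁅s, h⁆ * h ∈ leibQ s B r l :=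
        im _ _ _ (leibQ_anti hA r (by omega) hh.2) hh'
      have hX : (⁅⁅s, g⁆, ⁅s, h⁆⁆ * (⁅⁅s, h⁆, ⁅⁅s, g⁆, h⁆⁆ * ⁅⁅s, g⁆, h⁆)) ∈
          leibQ s B r (k + l + 1) := by
        have h1 := ic _ _ _ _ hg.2 hh'
        refine im _ _ _ (leibQ_anti hA r (by omega) (ic _ _ _ _ hg.2 hh.2))
          (im _ _ _ (leibQ_anti hA r (by omega) (ic _ _ _ _ hh.2 h1))
            (leibQ_anti hA r (by omega) h1))
      have hcX : ∀ x, x ∈ leibQ s B r (k + l + 1) →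
          ⁅g, h⁆ * x * ⁅g, h⁆⁻¹ ∈ leibQ s B r (k + l + 1) := by
        intro x hx
        have e2 : ⁅g, h⁆ * x * ⁅g, h⁆⁻¹ = ⁅⁅g, h⁆, x⁆ * x := by
          simp only [commutatorElement_def]; group
        rw [e2]
        exact im _ _ _ (leibQ_anti hA r (by omega) (ic _ _ _ _ hc hx)) hx
      rw [e]
      refine im _ _ _ (leibQ_anti hA r (by omega) (ic _ _ _ _ hg.2 (ic _ _ _ _ hg' hsh)))
        (im _ _ _ (leibQ_anti hA r (by omega) (ic _ _ _ _ hg' hh.2))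
          (im _ _ _ (leibQ_anti hA r (by omega) (ic _ _ _ _ hh.2 hc)) (hcX _ hX)))

theorem leibQ_conj (t : Γ) (hts : Commute t s)
    (ht : ∀ k x, x ∈ B k → t * x * t⁻¹ ∈ B k) (r : ℕ) :
    ∀ {k : ℕ} {g : Γ}, g ∈ leibQ s B r k → t * g * t⁻¹ ∈ leibQ s B r k := by
  induction r with
  | zero => intro k g h; exact ht _ _ h
  | succ r ih =>
    intro k g h
    refine ⟨ht _ _ h.1, ?_⟩
    have e : ⁅s, t * g * t⁻¹⁆ = t * ⁅s, g⁆ * t⁻¹ := by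
      simp only [commutatorElement_def]
      have h2 : s = t * s * t⁻¹ := by rw [hts.eq]; group
      calc s * (t * g * t⁻¹) * s⁻¹ * (t * g * t⁻¹)⁻¹
          = (t * s * t⁻¹) * (t * g * t⁻¹) * (t * s * t⁻¹)⁻¹ * (t * g * t⁻¹)⁻¹ := by rw [← h2]
        _ = _ := by group
    rw [e]
    exact ih h.2

/-- polynomial filtration -/
def leibP (s : Γ) (B : ℕ → Subgroup Γ) (hA : Antitone B)
    (hB : ∀ i j x y, x ∈ B i → y ∈ B j → ⁅x, y⁆ ∈ B (i + j)) (k : ℕ) : Subgroup Γ where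
  carrier := {g | ∀ r, g ∈ leibQ s B r k}
  one_mem' := fun r => (leibQ_main hA hB r).1 k
  mul_mem' := fun hx hy r => (leibQ_main hA hB r).2.1 k _ _ (hx r) (hy r)
  inv_mem' := fun hx r => (leibQ_main hA hB r).2.2.1 k _ (hx r)

/-- A group generated by polynomial elements of degree one and by the shift has
its lower central series inside the polynomial filtration. -/
theorem leib_lcs (hA : Antitone B)
    (hB : ∀ i j x y, x ∈ B i → y ∈ B j → ⁅x, y⁆ ∈ B (i + j))
    (hs' : ∀ k x, x ∈ B k → s⁻¹ * x * s ∈ B k)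
    {G : Type*} [Group G] (φ : G →* Γ) (S : Set G) (hS : Subgroup.closure S = ⊤)
    (hφ : ∀ g ∈ S, φ g = s ∨ φ g ∈ leibP s B hA hB 1) (n : ℕ) (g : G)
    (hg : g ∈ Subgroup.lowerCentralSeries (⊤ : Subgroup G) (n + 1)) : φ g ∈ B (n + 2) := by
  set P := leibP s B hA hB with hP
  have hPc : ∀ k l x y, x ∈ P k → y ∈ P l → ⁅x, y⁆ ∈ P (k + l) := fun k l x y hx hy r =>
    (leibQ_main hA hB r).2.2.2 k l x y (hx r) (hy r)
  have hPs : ∀ k x, x ∈ P k → ⁅s, x⁆ ∈ P (k + 1) := fun k x hx r => (hx (r + 1)).2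
  have hPconj : ∀ k x, x ∈ P k → s⁻¹ * x * s ∈ P k := fun k x hx r => by
    have := leibQ_conj s⁻¹ (Commute.refl s).inv_left
      (fun k x hx => by rw [inv_inv]; exact hs' k x hx) r (hx r)
    rwa [inv_inv] at this
  have hPs' : ∀ k x, x ∈ P k → ⁅s⁻¹, x⁆ ∈ P (k + 1) := fun k x hx => by
    have e : ⁅s⁻¹, x⁆ = s⁻¹ * ⁅s, x⁆⁻¹ * s := by simp only [commutatorElement_def]; group
    rw [e]
    exact hPconj _ _ ((P (k + 1)).inv_mem (hPs k x hx))
  have hcj : ∀ k x y, (∀ p ∈ P k, ⁅x, p⁆ ∈ P (k + 1)) → y ∈ P k → x * y * x⁻¹ ∈ P k := by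
    intro k x y hx hy
    have e : x * y * x⁻¹ = ⁅x, y⁆ * y := by simp only [commutatorElement_def]; group
    rw [e]
    refine (P k).mul_mem (fun r => leibQ_anti hA r (Nat.le_succ k) (hx y hy r)) hy
  have hD : ∀ g : G, (∀ k, ∀ p ∈ P k, ⁅φ g, p⁆ ∈ P (k + 1)) ∧
      (∀ k, ∀ p ∈ P k, ⁅(φ g)⁻¹, p⁆ ∈ P (k + 1)) := by
    have hmul : ∀ x y : Γ, (∀ k, ∀ p ∈ P k, ⁅x, p⁆ ∈ P (k + 1)) →
        (∀ k, ∀ p ∈ P k, ⁅y, p⁆ ∈ P (k + 1)) → (∀ k, ∀ p ∈ P k, ⁅x * y, p⁆ ∈ P (k + 1)) := by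
      intro x y hx hy k p hp
      have e : ⁅x * y, p⁆ = (x * ⁅y, p⁆ * x⁻¹) * ⁅x, p⁆ := by
        simp only [commutatorElement_def]; group
      rw [e]
      exact (P (k + 1)).mul_mem (hcj _ _ _ (hx (k + 1)) (hy k p hp)) (hx k p hp)
    intro g
    have hg : g ∈ Subgroup.closure S := by rw [hS]; trivial
    induction hg using Subgroup.closure_induction with
    | mem x hx =>
      rcases hφ x hx with h | h
      · rw [h]; exact ⟨hPs, hPs'⟩
      · exact ⟨fun k p hp => by rw [add_comm]; exact hPc _ _ _ _ h hp,
          fun k p hp => by rw [add_comm]; exact hPc _ _ _ _ ((P 1).inv_mem h) hp⟩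
    | one => simp [(P _).one_mem]
    | mul x y _ _ hx hy =>
      rw [map_mul, mul_inv_rev]
      exact ⟨hmul _ _ hx.1 hy.1, hmul _ _ hy.2 hx.2⟩
    | inv x _ hx => rw [map_inv, inv_inv]; exact ⟨hx.2, hx.1⟩
  have hone : ∀ y : Γ, (∀ g ∈ S, ⁅φ g, y⁆ ∈ P 2) → ∀ g : G, ⁅φ g, y⁆ ∈ P 2 := by
    intro y hy g
    have hg : g ∈ Subgroup.closure S := by rw [hS]; trivial
    induction hg using Subgroup.closure_induction with
    | mem x hx => exact hy x hx
    | one => simp [(P 2).one_mem]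
    | mul x x' _ _ hx hx' =>
      have e : ⁅φ (x * x'), y⁆ = (φ x * ⁅φ x', y⁆ * (φ x)⁻¹) * ⁅φ x, y⁆ := by
        simp only [commutatorElement_def, map_mul]; group
      rw [e]
      exact (P 2).mul_mem (hcj _ _ _ ((hD x).1 2) hx') hx
    | inv x _ hx =>
      have e : ⁅φ x⁻¹, y⁆ = (φ x)⁻¹ * ⁅φ x, y⁆⁻¹ * (φ x)⁻¹⁻¹ := by
        simp only [commutatorElement_def, map_inv]; group
      rw [e]
      exact hcj _ _ _ ((hD x).2 2) ((P 2).inv_mem hx)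
  have hflip : ∀ x y k, ⁅x, y⁆ ∈ P k → ⁅y, x⁆ ∈ P k := fun x y k h => by
    rw [← commutatorElement_inv]; exact (P k).inv_mem h
  have hgen : ∀ x ∈ S, ∀ y ∈ S, ⁅φ x, φ y⁆ ∈ P 2 := by
    intro x hx y hy
    rcases hφ y hy with h | h
    · rcases hφ x hx with h' | h'
      · rw [h, h', commutatorElement_self]; exact (P 2).one_mem
      · rw [h]; exact hflip _ _ _ (hPs 1 _ h')
    · exact (hD x).1 1 _ h
  have hall : ∀ x y : G, ⁅φ x, φ y⁆ ∈ P 2 := fun x y =>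
    hone _ (fun g hg => hflip _ _ _ (hone _ (fun g' hg' => hgen g' hg' g hg) y)) x
  have key : ∀ n, Subgroup.lowerCentralSeries (⊤ : Subgroup G) (n + 1) ≤
      (P (n + 2)).comap φ := by
    intro n
    induction n with
    | zero =>
      rw [Subgroup.lowerCentralSeries_succ, Subgroup.commutator_le]
      intro x _ y _
      rw [Subgroup.mem_comap, map_commutatorElement]
      exact hall x y
    | succ n ih =>
      rw [Subgroup.lowerCentralSeries_succ, Subgroup.commutator_le]
      intro x hx y _
      rw [Subgroup.mem_comap, map_commutatorElement]
      exact hflip _ _ _ ((hD y).1 _ _ (ih hx))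
  exact leibQ_B (key n hg 0)

end Leib


section LieGrp

/-- filtered cubic Lie data -/
structure LD (V Z : Type) [AddCommGroup V] [CommRing Z] where
  c : V →+ V →+ V →+ Z
  alt : ∀ v w, c v v w = 0
  jac : ∀ u v w, c u v w + c v w u + c w u v = 0
  S : AddSubgroup V
  hS : ∀ s ∈ S, ∀ v w, 3 * c s v w = 0
  hS' : ∀ s ∈ S, ∀ v w, 3 * c v w s = 0
  hSS : ∀ s ∈ S, ∀ t ∈ S, c s t t = 0
  F : ℕ → AddSubgroup V
  anti : Antitone F
  F0 : F 0 = ⊤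
  F7 : F 7 = ⊥
  hF : ∀ i j l, 7 ≤ i + j + l → ∀ u ∈ F i, ∀ v ∈ F j, ∀ w ∈ F l, 3 * c u v w = 0

variable {V Z : Type} [AddCommGroup V] [CommRing Z]

theorem LD.skew (D : LD V Z) (u v w : V) : D.c u v w = - D.c v u w := by
  have h := D.alt (u + v) w
  simp only [map_add, AddMonoidHom.add_apply, D.alt] at h
  linear_combination h

/-- the class three group attached to the data -/
@[ext] structure LN (D : LD V Z) where
  v : V
  m : V →+ Z
  z : Z
  hm : ∀ s ∈ D.S, m s = 0

variable {D : LD V Z}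

/-- three times the bracket -/
def LD.b (D : LD V Z) (u v : V) : V →+ Z := D.c u v + D.c u v + D.c u v

theorem LD.b_apply (u v w : V) : D.b u v w = 3 * D.c u v w := by
  simp only [LD.b, AddMonoidHom.add_apply]; ring

instance : Mul (LN D) := ⟨fun x y => ⟨x.v + y.v, x.m + y.m + D.b x.v y.v,
  x.z + y.z + x.m y.v - y.m x.v + D.c y.v x.v x.v + D.c x.v y.v y.v, by
    intro s hs
    simp only [AddMonoidHom.add_apply, x.hm s hs, y.hm s hs, LD.b_apply, D.hS' s hs, add_zero]⟩⟩
instance : One (LN D) := ⟨⟨0, 0, 0, fun _ _ => rfl⟩⟩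
instance : Inv (LN D) := ⟨fun x => ⟨-x.v, -x.m, -x.z, by
    intro s hs
    simp only [AddMonoidHom.neg_apply, x.hm s hs, neg_zero]⟩⟩

theorem LN.mul_v (x y : LN D) : (x * y).v = x.v + y.v := rfl
theorem LN.mul_m (x y : LN D) : (x * y).m = x.m + y.m + D.b x.v y.v := rfl
theorem LN.mul_z (x y : LN D) : (x * y).z =
  x.z + y.z + x.m y.v - y.m x.v + D.c y.v x.v x.v + D.c x.v y.v y.v := rfl
theorem LN.one_v : (1 : LN D).v = 0 := rfl
theorem LN.one_m : (1 : LN D).m = 0 := rfl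
theorem LN.one_z : (1 : LN D).z = 0 := rfl
theorem LN.inv_v (x : LN D) : (x⁻¹).v = -x.v := rfl
theorem LN.inv_m (x : LN D) : (x⁻¹).m = -x.m := rfl
theorem LN.inv_z (x : LN D) : (x⁻¹).z = -x.z := rfl

instance : Group (LN D) := Group.ofLeftAxioms
  (by
    intro x y w
    ext u
    · simp only [LN.mul_v]; abel
    · simp only [LN.mul_m, LN.mul_v, AddMonoidHom.add_apply, LD.b_apply, map_add]; ring
    · simp only [LN.mul_z, LN.mul_m, LN.mul_v, AddMonoidHom.add_apply, LD.b_apply, map_add]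
      linear_combination 2 * D.jac x.v y.v w.v + D.skew w.v y.v x.v - D.skew x.v w.v y.v)
  (by
    intro x
    ext u
    · simp only [LN.mul_v, LN.one_v, zero_add]
    · simp only [LN.mul_m, LN.one_v, LN.one_m, AddMonoidHom.add_apply, LD.b_apply, map_zero,
        AddMonoidHom.zero_apply]; ring
    · simp only [LN.mul_z, LN.one_v, LN.one_m, LN.one_z, map_zero,
        AddMonoidHom.zero_apply]; ring)
  (by
    intro x
    ext u
    · simp only [LN.mul_v, LN.inv_v, LN.one_v, neg_add_cancel]
    · simp only [LN.mul_m, LN.inv_v, LN.inv_m, LN.one_m, AddMonoidHom.add_apply, LD.b_apply,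
        map_neg, AddMonoidHom.neg_apply, AddMonoidHom.zero_apply, D.alt]; ring
    · simp only [LN.mul_z, LN.inv_v, LN.inv_m, LN.inv_z, LN.one_z, 
        map_neg, AddMonoidHom.neg_apply, D.alt]; ring)

theorem LN.comm_v (x y : LN D) : ⁅x, y⁆.v = 0 := by
  simp only [commutatorElement_def, LN.mul_v, LN.inv_v]; abel

theorem LN.comm_m (x y : LN D) (w : V) : ⁅x, y⁆.m w = 6 * D.c x.v y.v w := by
  simp only [commutatorElement_def, LN.mul_m, LN.inv_m, LN.mul_v, LN.inv_v, LD.b_apply,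
    AddMonoidHom.add_apply, AddMonoidHom.neg_apply, map_neg, map_add, D.alt]
  linear_combination -3 * D.skew x.v y.v w

theorem LN.comm_z (x y : LN D) : ⁅x, y⁆.z =
    2 * x.m y.v - 2 * y.m x.v - 6 * D.c x.v y.v (x.v + y.v) := by
  simp only [commutatorElement_def, LN.mul_z, LN.inv_z, LN.mul_m, LN.inv_m, LN.mul_v, LN.inv_v,
    LD.b_apply, AddMonoidHom.add_apply, AddMonoidHom.neg_apply, map_neg, map_add, D.alt,
    D.skew y.v x.v]
  ring

/-- pure elements -/
def LN.pure (D : LD V Z) (v : V) : LN D := ⟨v, 0, 0, fun _ _ => rfl⟩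

theorem LN.pure_npow (v : V) (n : ℕ) : LN.pure D v ^ n = LN.pure D (n • v) := by
  induction n with
  | zero => rw [pow_zero, zero_smul]; rfl
  | succ n ih =>
    rw [pow_succ, ih, succ_nsmul]
    ext u
    · simp only [LN.mul_v, LN.pure]
    · simp only [LN.mul_m, LN.pure, AddMonoidHom.add_apply, LD.b_apply, map_nsmul,
        AddMonoidHom.nsmul_apply, D.alt, AddMonoidHom.zero_apply]; simp
    · simp only [LN.mul_z, LN.pure, map_nsmul,
        AddMonoidHom.nsmul_apply, D.alt, AddMonoidHom.zero_apply]; simp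

theorem LN.zpart_npow (x : LN D) (hv : x.v = 0) (n : ℕ) :
    (x ^ n).v = 0 ∧ (x ^ n).z = n * x.z := by
  induction n with
  | zero => rw [pow_zero]; exact ⟨rfl, by simp [LN.one_z]⟩
  | succ n ih =>
    rw [pow_succ, LN.mul_v, LN.mul_z, ih.1, ih.2, hv]
    refine ⟨add_zero _, ?_⟩
    simp only [map_zero, AddMonoidHom.zero_apply]
    push_cast; ring

/-- the central subgroup to be divided out -/
def LN.C (D : LD V Z) : Subgroup (LN D) where
  carrier := {x | x.v ∈ D.S ∧ x.m = 0 ∧ x.z = 0}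
  one_mem' := ⟨D.S.zero_mem, rfl, rfl⟩
  mul_mem' := by
    rintro x y ⟨h1, h2, h3⟩ ⟨h4, h5, h6⟩
    refine ⟨D.S.add_mem h1 h4, ?_, ?_⟩
    · ext w
      simp only [LN.mul_m, AddMonoidHom.add_apply, LD.b_apply, h2, h5, D.hS _ h1,
        AddMonoidHom.zero_apply, add_zero]
    · simp only [LN.mul_z, h2, h3, h5, h6, D.hSS _ h1 _ h4, D.hSS _ h4 _ h1,
        AddMonoidHom.zero_apply, add_zero, sub_zero]
  inv_mem' := by
    rintro x ⟨h1, h2, h3⟩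
    refine ⟨D.S.neg_mem h1, ?_, ?_⟩
    · rw [LN.inv_m, h2, neg_zero]
    · rw [LN.inv_z, h3, neg_zero]

theorem LN.C_comm (x y : LN D) (hx : x ∈ LN.C D) : ⁅x, y⁆ = 1 := by
  obtain ⟨h1, h2, h3⟩ := hx
  ext w
  · exact LN.comm_v x y
  · rw [LN.comm_m, LN.one_m, AddMonoidHom.zero_apply]
    linear_combination 2 * D.hS _ h1 y.v w
  · rw [LN.comm_z, h2, y.hm _ h1, LN.one_z, AddMonoidHom.zero_apply]
    linear_combination -2 * D.hS _ h1 y.v (x.v + y.v)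

instance LN.C_normal : (LN.C D).Normal := ⟨fun x hx y => by
  have h := LN.C_comm x y hx
  rw [commutatorElement_eq_one_iff_mul_comm] at h
  rw [← h, mul_inv_cancel_right]; exact hx⟩

/-- the filtration -/
def LN.B (D : LD V Z) (k : ℕ) : Subgroup (LN D) where
  carrier := {x | x.v ∈ D.F k ∧ (∀ l, 7 ≤ k + l → ∀ w ∈ D.F l, x.m w = 0) ∧ (7 ≤ k → x.z = 0)}
  one_mem' := ⟨(D.F k).zero_mem, fun _ _ _ _ => rfl, fun _ => rfl⟩
  mul_mem' := by
    rintro x y ⟨h1, h2, h3⟩ ⟨h4, h5, h6⟩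
    refine ⟨(D.F k).add_mem h1 h4, fun l hl w hw => ?_, fun hk => ?_⟩
    · simp only [LN.mul_m, AddMonoidHom.add_apply, LD.b_apply, h2 l hl w hw, h5 l hl w hw,
        D.hF k k l (by omega) _ h1 _ h4 _ hw, add_zero]
    · have hx0 : x.v = 0 := by
        have := D.anti hk h1; rwa [D.F7, AddSubgroup.mem_bot] at this
      have hy0 : y.v = 0 := by
        have := D.anti hk h4; rwa [D.F7, AddSubgroup.mem_bot] at this
      simp only [LN.mul_z, h3 hk, h6 hk, hx0, hy0, map_zero, 
        AddMonoidHom.zero_apply, add_zero, sub_zero]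
  inv_mem' := by
    rintro x ⟨h1, h2, h3⟩
    refine ⟨(D.F k).neg_mem h1, fun l hl w hw => ?_, fun hk => ?_⟩
    · rw [LN.inv_m, AddMonoidHom.neg_apply, h2 l hl w hw, neg_zero]
    · rw [LN.inv_z, h3 hk, neg_zero]

theorem LN.B_anti : Antitone (LN.B D) := by
  rintro k l hkl x ⟨h1, h2, h3⟩
  exact ⟨D.anti hkl h1, fun j hj w hw => h2 j (by omega) w hw, fun hk => h3 (by omega)⟩

theorem LN.B_comm (i j : ℕ) (x y : LN D) (hx : x ∈ LN.B D i) (hy : y ∈ LN.B D j) :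
    ⁅x, y⁆ ∈ LN.B D (i + j) := by
  obtain ⟨h1, h2, h3⟩ := hx
  obtain ⟨h4, h5, h6⟩ := hy
  refine ⟨?_, fun l hl w hw => ?_, fun hk => ?_⟩
  · rw [LN.comm_v]; exact (D.F _).zero_mem
  · rw [LN.comm_m]
    linear_combination 2 * D.hF i j l hl _ h1 _ h4 _ hw
  · rw [LN.comm_z, h2 j hk _ h4, h5 i (by omega) _ h1]
    linear_combination -2 * D.hF i j 0 (by omega) _ h1 _ h4 (x.v + y.v) (by rw [D.F0]; trivial)

theorem LN.B_seven (x : LN D) (hx : x ∈ LN.B D 7) : x = 1 := by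
  obtain ⟨h1, h2, h3⟩ := hx
  ext w
  · rwa [D.F7, AddSubgroup.mem_bot] at h1
  · exact h2 0 le_rfl w (by rw [D.F0]; trivial)
  · exact h3 le_rfl

theorem LN.pure_mem (k : ℕ) (v : V) (hv : v ∈ D.F k) : LN.pure D v ∈ LN.B D k :=
  ⟨hv, fun _ _ _ _ => rfl, fun _ => rfl⟩

end LieGrp


section Table

/-- sparse coefficient table -/
def tTab : List (ℕ × ℤ) := [
    (17, 1 * 3 ^ 4), (23, 5 * 3 ^ 10), (31, 5 * 3 ^ 9), (51, 8 * 3 ^ 8), (58, 1 * 3 ^ 10),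
    (67, 5 * 3 ^ 3), (83, 12), (86, 4 * 3 ^ 8), (87, 4 * 3 ^ 9), (88, 1 * 3 ^ 3),
    (94, 23 * 3 ^ 7), (95, 79 * 3 ^ 8), (114, 2 * 3 ^ 8), (115, 23 * 3 ^ 7),
    (122, 2 * 3 ^ 9), (131, 13 * 3 ^ 2), (136, 2 * 3 ^ 4), (152, 5 * 3 ^ 2), (153, 6),
    (154, 2), (158, 79 * 3 ^ 6), (159, 4 * 3 ^ 7), (171, 4 * 3 ^ 4), (178, 2 * 3 ^ 7),
    (179, 77 * 3 ^ 6), (186, 2 * 3 ^ 8), (195, 21), (203, 2), (235, 7 * 3 ^ 3),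
    (243, 2 * 3 ^ 5)]

/-- generating cubic coefficients -/
def tG (i j k : Fin 8) : ℤ := (tTab.lookup (64 * i.val + 8 * j.val + k.val)).getD 0

/-- structure constants -/
def tC (i j k : Fin 8) : ℤ := tG i j k - tG j i k - tG k i j + tG k j i

/-- weights of the filtration -/
def tD : ℕ → Fin 8 → ℤ
  | 0 => fun _ => 1
  | 1 => fun _ => 1
  | 2 => ![1, 9, 81, 729, 1, 1, 1, 1]
  | 3 => ![0, 0, 0, 0, 1, 1, 1, 1]
  | _ + 4 => fun _ => 0

/-- the relation vectors, divided by nine -/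
def tR : Fin 4 → Fin 8 → ℤ := ![
  ![3 ^ 9, 3 ^ 10, 0, 0, - 3 ^ 8, 0, 0, 0],
  ![3 ^ 8, 0, 3 ^ 10, 0, 0, - 3 ^ 6, 0, 0],
  ![0, 3 ^ 7, 0, 3 ^ 9, 0, 0, - 3 ^ 2, 0],
  ![0, 0, 3 ^ 7, 3 ^ 8, 0, 0, 0, - 1]]

theorem tC_skew : ∀ i j k, tC i j k = - tC j i k := by decide +kernel
theorem tC_jac : ∀ i j k, tC i j k + tC j k i + tC k i j = 0 := by decide +kernel
theorem tC_filt : ∀ a b c : Fin 4, 7 ≤ a.val + b.val + c.val → ∀ i j k,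
    (3 * (tC i j k * tD a i * tD b j * tD c k)) % 3 ^ 15 = 0 := by decide +kernel
theorem tC_rel : ∀ r : Fin 4, ∀ i j, (3 * ∑ l, tC l i j * (9 * tR r l)) % 3 ^ 15 = 0 := by
  decide +kernel
theorem tC_rel' : ∀ r : Fin 4, ∀ i j, (3 * ∑ l, tC i j l * (9 * tR r l)) % 3 ^ 15 = 0 := by
  decide +kernel
theorem tC_val : tC 2 1 0 = 81 := by decide +kernel

/-- the coefficient ring -/
abbrev RR : Type := ZMod (3 ^ 15)

theorem RR_zero (a : ℤ) (h : a % 3 ^ 15 = 0) : (a : RR) = 0 := by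
  refine (ZMod.intCast_zmod_eq_zero_iff_dvd a (3 ^ 15)).2 ?_
  exact_mod_cast Int.dvd_of_emod_eq_zero h

/-- the module -/
abbrev VV : Type := Fin 8 → RR

/-- the cubic form -/
def tc (x y z : VV) : RR := ∑ i, ∑ j, ∑ k, (tC i j k : RR) * x i * y j * z k

theorem tc_add1 (x x' y z : VV) : tc (x + x') y z = tc x y z + tc x' y z := by
  simp only [tc, ← Finset.sum_add_distrib, Pi.add_apply]
  refine Finset.sum_congr rfl fun i _ => Finset.sum_congr rfl fun j _ =>
    Finset.sum_congr rfl fun k _ => by ring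
theorem tc_add2 (x y y' z : VV) : tc x (y + y') z = tc x y z + tc x y' z := by
  simp only [tc, ← Finset.sum_add_distrib, Pi.add_apply]
  refine Finset.sum_congr rfl fun i _ => Finset.sum_congr rfl fun j _ =>
    Finset.sum_congr rfl fun k _ => by ring
theorem tc_add3 (x y z z' : VV) : tc x y (z + z') = tc x y z + tc x y z' := by
  simp only [tc, ← Finset.sum_add_distrib, Pi.add_apply]
  refine Finset.sum_congr rfl fun i _ => Finset.sum_congr rfl fun j _ =>
    Finset.sum_congr rfl fun k _ => by ring

theorem tc_skew (x y z : VV) : tc x y z = - tc y x z := by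
  unfold tc
  rw [Finset.sum_comm]
  simp only [← Finset.sum_neg_distrib]
  refine Finset.sum_congr rfl fun i _ => Finset.sum_congr rfl fun j _ =>
    Finset.sum_congr rfl fun k _ => ?_
  rw [tC_skew]; push_cast; ring

theorem tc_alt (x z : VV) : tc x x z = 0 := by
  have h := tc_skew x x z
  have h2 : (2 : RR) * 7174454 = 1 := by decide +kernel
  linear_combination (-tc x x z) * h2 + 7174454 * h

theorem tc_rot (x y z : VV) :
    tc y z x = ∑ i, ∑ j, ∑ k, (tC j k i : RR) * x i * y j * z k := by
  unfold tc
  have : ∀ i : Fin 8, ∑ j, ∑ k, (tC i j k : RR) * y i * z j * x k =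
      ∑ k, ∑ j, (tC i j k : RR) * y i * z j * x k := fun i => Finset.sum_comm
  simp only [this]
  rw [Finset.sum_comm]
  refine Finset.sum_congr rfl fun i _ => Finset.sum_congr rfl fun j _ =>
    Finset.sum_congr rfl fun k _ => by ring

theorem tc_rot2 (x y z : VV) :
    tc z x y = ∑ i, ∑ j, ∑ k, (tC k i j : RR) * x i * y j * z k := by
  unfold tc
  rw [Finset.sum_comm]
  refine Finset.sum_congr rfl fun i _ => ?_
  rw [Finset.sum_comm]
  refine Finset.sum_congr rfl fun j _ =>
    Finset.sum_congr rfl fun k _ => by ring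

theorem tc_jac (x y z : VV) : tc x y z + tc y z x + tc z x y = 0 := by
  rw [tc_rot x y z, tc_rot2 x y z]
  simp only [tc, ← Finset.sum_add_distrib]
  refine Finset.sum_eq_zero fun i _ => Finset.sum_eq_zero fun j _ =>
    Finset.sum_eq_zero fun k _ => ?_
  have := congrArg (Int.cast : ℤ → RR) (tC_jac i j k)
  push_cast at this
  linear_combination x i * y j * z k * this

/-- weights in the ring -/
def tDR (k : ℕ) : VV := fun i => (tD k i : RR)

theorem tc_filt (a b c : ℕ) (h : 7 ≤ a + b + c) (x y z : VV) :
    3 * tc (tDR a * x) (tDR b * y) (tDR c * z) = 0 := by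
  unfold tc
  simp only [Finset.mul_sum]
  refine Finset.sum_eq_zero fun i _ => Finset.sum_eq_zero fun j _ =>
    Finset.sum_eq_zero fun k _ => ?_
  have key : ((3 * (tC i j k * tD a i * tD b j * tD c k) : ℤ) : RR) = 0 := by
    by_cases ha : a < 4
    · by_cases hb : b < 4
      · by_cases hc : c < 4
        · exact RR_zero _ (tC_filt ⟨a, ha⟩ ⟨b, hb⟩ ⟨c, hc⟩ h i j k)
        · obtain ⟨c, rfl⟩ : ∃ d, c = d + 4 := ⟨c - 4, by omega⟩
          simp [tD]
      · obtain ⟨b, rfl⟩ : ∃ d, b = d + 4 := ⟨b - 4, by omega⟩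
        simp [tD]
    · obtain ⟨a, rfl⟩ : ∃ d, a = d + 4 := ⟨a - 4, by omega⟩
      simp [tD]
  push_cast at key
  simp only [Pi.mul_apply, tDR]
  linear_combination x i * y j * z k * key

/-- relation vectors -/
def tRR (r : Fin 4) : VV := fun i => ((9 * tR r i : ℤ) : RR)

theorem tc_rel (r : Fin 4) (y z : VV) : 3 * tc (tRR r) y z = 0 := by
  rw [tc_rot2 y z (tRR r)]
  rw [Finset.mul_sum]
  refine Finset.sum_eq_zero fun i _ => ?_
  rw [Finset.mul_sum]
  refine Finset.sum_eq_zero fun j _ => ?_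
  have h := RR_zero _ (tC_rel r i j)
  push_cast at h
  have : 3 * ∑ k, (tC k i j : RR) * y i * z j * tRR r k =
      y i * z j * (3 * ∑ l, (tC l i j : RR) * (9 * (tR r l : RR))) := by
    simp only [Finset.mul_sum]
    refine Finset.sum_congr rfl fun l _ => ?_
    simp only [tRR]; push_cast; ring
  rw [this, h, mul_zero]

theorem tc_rel' (r : Fin 4) (y z : VV) : 3 * tc y z (tRR r) = 0 := by
  unfold tc
  rw [Finset.mul_sum]
  refine Finset.sum_eq_zero fun i _ => ?_
  rw [Finset.mul_sum]
  refine Finset.sum_eq_zero fun j _ => ?_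
  have h := RR_zero _ (tC_rel' r i j)
  push_cast at h
  have : 3 * ∑ k, (tC i j k : RR) * y i * z j * tRR r k =
      y i * z j * (3 * ∑ l, (tC i j l : RR) * (9 * (tR r l : RR))) := by
    simp only [Finset.mul_sum]
    refine Finset.sum_congr rfl fun l _ => ?_
    simp only [tRR]; push_cast; ring
  rw [this, h, mul_zero]

end Table


section Conc

/-- the cubic form as a triadditive map -/
def tcH : VV →+ VV →+ VV →+ RR :=
  AddMonoidHom.mk' (fun x => AddMonoidHom.mk' (fun y => AddMonoidHom.mk' (fun z => tc x y z)
    (tc_add3 x y)) (fun y y' => AddMonoidHom.ext fun z => tc_add2 x y y' z))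
    (fun x x' => AddMonoidHom.ext fun y => AddMonoidHom.ext fun z => tc_add1 x x' y z)

theorem tcH_apply (x y z : VV) : tcH x y z = tc x y z := rfl

/-- the span of the relation vectors -/
def tS : AddSubgroup VV := AddSubgroup.closure (Set.range tRR)

theorem tS_rel (s : VV) (hs : s ∈ tS) (y z : VV) : 3 * tcH s y z = 0 := by
  induction hs using AddSubgroup.closure_induction with
  | mem x hx => obtain ⟨r, rfl⟩ := hx; exact tc_rel r y z
  | zero => simp
  | add x x' _ _ h h' =>
    simp only [map_add, AddMonoidHom.add_apply]; linear_combination h + h'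
  | neg x _ h =>
    simp only [map_neg, AddMonoidHom.neg_apply]; linear_combination -h

theorem tS_rel' (s : VV) (hs : s ∈ tS) (y z : VV) : 3 * tcH y z s = 0 := by
  induction hs using AddSubgroup.closure_induction with
  | mem x hx => obtain ⟨r, rfl⟩ := hx; exact tc_rel' r y z
  | zero => simp
  | add x x' _ _ h h' =>
    simp only [map_add]; linear_combination h + h'
  | neg x _ h =>
    simp only [map_neg]; linear_combination -h

theorem tS_nine (s : VV) (hs : s ∈ tS) : ∃ t : VV, s = 9 • t := by
  induction hs using AddSubgroup.closure_induction with
  | mem x hx =>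
    obtain ⟨r, rfl⟩ := hx
    refine ⟨fun i => (tR r i : RR), ?_⟩
    funext i
    simp [tRR]
  | zero => exact ⟨0, by simp⟩
  | add x x' _ _ h h' =>
    obtain ⟨t, ht⟩ := h
    obtain ⟨t', ht'⟩ := h'
    exact ⟨t + t', by rw [smul_add, ← ht, ← ht']⟩
  | neg x _ h =>
    obtain ⟨t, ht⟩ := h
    exact ⟨-t, by rw [smul_neg, ← ht]⟩

/-- the filtration of the module -/
def tF (k : ℕ) : AddSubgroup VV := (AddMonoidHom.mulLeft (tDR k)).range

theorem mem_tF (k : ℕ) (v : VV) : v ∈ tF k ↔ ∃ x, tDR k * x = v := Iff.rfl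

theorem tF_anti : Antitone tF := by
  refine antitone_nat_of_succ_le fun k => ?_
  rintro v ⟨x, rfl⟩
  have h : ∃ q, tDR (k + 1) = tDR k * q := by
    match k with
    | 0 => exact ⟨1, by rw [mul_one]; rfl⟩
    | 1 => exact ⟨tDR 2, by funext i; simp [tDR, tD]⟩
    | 2 => exact ⟨tDR 3, by funext i; fin_cases i <;> simp [tDR, tD]⟩
    | k + 3 => exact ⟨0, by rw [mul_zero]; funext i; simp [tDR, tD]⟩
  obtain ⟨q, hq⟩ := h
  exact ⟨q * x, by simp only [AddMonoidHom.coe_mulLeft]; rw [hq, mul_assoc]⟩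

/-- the concrete data -/
def tLD : LD VV RR where
  c := tcH
  alt := tc_alt
  jac := tc_jac
  S := tS
  hS := tS_rel
  hS' := tS_rel'
  hSS := by
    intro s hs t ht
    obtain ⟨u, hu⟩ := tS_nine t ht
    have h := tS_rel s hs u t
    nth_rewrite 1 [hu]
    rw [map_nsmul, AddMonoidHom.nsmul_apply, nsmul_eq_mul]
    push_cast
    linear_combination 3 * h
  F := tF
  anti := tF_anti
  F0 := by
    rw [eq_top_iff]
    intro v _
    exact ⟨v, by funext i; simp [tDR, tD]⟩
  F7 := by
    rw [eq_bot_iff]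
    rintro v ⟨x, rfl⟩
    rw [AddSubgroup.mem_bot]
    funext i; simp [tDR, tD]
  hF := by
    rintro i j l h _ ⟨x, rfl⟩ _ ⟨y, rfl⟩ _ ⟨z, rfl⟩
    exact tc_filt i j l h x y z

/-- the basis vectors -/
def tE (i : Fin 8) : VV := Pi.single i 1

theorem tc_basis (i j k : Fin 8) : tcH (tE i) (tE j) (tE k) = (tC i j k : RR) := by
  rw [tcH_apply]
  simp [tc, tE, Pi.single_apply]

/-- the index of a generator -/
def iE (i : Fin 4) : Fin 8 := ⟨i.val, by omega⟩
/-- the index of a triple commutator generator -/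
def iY (k : Fin 4) : Fin 8 := ⟨k.val + 4, by omega⟩

theorem tE_one (v : VV) : v ∈ tF 1 := ⟨v, by funext i; simp [tDR, tD]⟩

theorem tE_two (i : Fin 4) : (3 ^ (2 * (i : ℕ))) • tE (iE i) ∈ tF 2 := by
  refine ⟨tE (iE i), ?_⟩
  funext l
  fin_cases i <;> fin_cases l <;> simp [tDR, tD, tE, iE] 

theorem tE_three (k : Fin 4) : tE (iY k) ∈ tF 3 := by
  refine ⟨tE (iY k), ?_⟩
  funext l
  fin_cases k <;> fin_cases l <;> simp [tDR, tD, tE, iY]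

/-- the quotient group -/
abbrev NN : Type := LN tLD ⧸ LN.C tLD

/-- image of a module element -/
def pN (v : VV) : NN := QuotientGroup.mk' (LN.C tLD) (LN.pure tLD v)

/-- the filtration of the quotient -/
def NB (k : ℕ) : Subgroup NN := (LN.B tLD k).map (QuotientGroup.mk' (LN.C tLD))

theorem NB_anti : Antitone NB := fun _ _ h => Subgroup.map_mono (LN.B_anti h)

theorem NB_comm (i j : ℕ) (x y : NN) (hx : x ∈ NB i) (hy : y ∈ NB j) : ⁅x, y⁆ ∈ NB (i + j) := by
  obtain ⟨x, hx, rfl⟩ := hx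
  obtain ⟨y, hy, rfl⟩ := hy
  exact ⟨⁅x, y⁆, LN.B_comm i j x y hx hy, map_commutatorElement _ _ _⟩

theorem NB_seven (x : NN) (hx : x ∈ NB 7) : x = 1 := by
  obtain ⟨x, hx, rfl⟩ := hx
  rw [LN.B_seven x hx, map_one]

theorem pN_pow (v : VV) (n : ℕ) : pN v ^ n = pN (n • v) := by
  rw [pN, ← map_pow, LN.pure_npow]; rfl

theorem pN_one (v : VV) : pN v ∈ NB 1 := ⟨_, LN.pure_mem 1 v (tE_one v), rfl⟩
theorem pN_two (i : Fin 4) : pN (tE (iE i)) ^ (3 ^ (2 * (i : ℕ))) ∈ NB 2 := by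
  rw [pN_pow]; exact ⟨_, LN.pure_mem 2 _ (tE_two i), rfl⟩
theorem pN_three (k : Fin 4) : pN (tE (iY k)) ∈ NB 3 := ⟨_, LN.pure_mem 3 _ (tE_three k), rfl⟩

theorem pN_omega : ⁅⁅pN (tE 2), pN (tE 1)⁆, pN (tE 0)⁆ ^ (3 ^ 9) ≠ 1 := by
  set x := LN.pure tLD (tE 2) with hx
  set y := LN.pure tLD (tE 1) with hy
  set z := LN.pure tLD (tE 0) with hz
  have e : ⁅⁅pN (tE 2), pN (tE 1)⁆, pN (tE 0)⁆ ^ (3 ^ 9) =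
      QuotientGroup.mk' (LN.C tLD) (⁅⁅x, y⁆, z⁆ ^ (3 ^ 9)) := by
    rw [map_pow, map_commutatorElement, map_commutatorElement]; rfl
  rw [e]
  intro h
  rw [QuotientGroup.mk'_apply, QuotientGroup.eq_one_iff] at h
  have h3 := h.2.2
  rw [(LN.zpart_npow _ (LN.comm_v _ _) _).2, LN.comm_z, LN.comm_m, LN.comm_v] at h3
  have e1 : x.v = tE 2 := rfl
  have e2 : y.v = tE 1 := rfl
  have e3 : z.v = tE 0 := rfl
  have e4 : z.m = 0 := rfl
  have e5 : tLD.c = tcH := rfl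
  rw [e1, e2, e3, e4, e5, tc_basis, tC_val] at h3
  simp only [map_zero, AddMonoidHom.zero_apply, mul_zero, sub_zero] at h3
  revert h3
  decide +kernel

theorem LN.rel_mem {V Z : Type} [AddCommGroup V] [CommRing Z] {D : LD V Z} (u w t t' : V)
    (h1 : ∀ x, D.c u w x = 0) (hS : u + w - t ∈ D.S) (ht : t = 3 • t') :
    LN.pure D u * LN.pure D w * (LN.pure D t)⁻¹ ∈ LN.C D := by
  obtain ⟨r, hr⟩ : ∃ r, u + w - t = r := ⟨_, rfl⟩
  rw [hr] at hS
  have huw : u + w = r + t := by rw [← hr]; abel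
  have h2 : ∀ x, D.c w u x = 0 := fun x => by rw [D.skew, h1, neg_zero]
  have h3 : ∀ x, D.c r t x = 0 := fun x => by
    rw [ht, map_nsmul, AddMonoidHom.nsmul_apply, nsmul_eq_mul]
    exact_mod_cast D.hS r hS t' x
  have h4 : ∀ x, D.c t r x = 0 := fun x => by rw [D.skew, h3, neg_zero]
  refine ⟨?_, ?_, ?_⟩
  · simp only [LN.mul_v, LN.inv_v, LN.pure, ← sub_eq_add_neg, hr]; exact hS
  · ext x
    simp only [LN.mul_m, LN.mul_v, LN.inv_v, LN.inv_m, LN.pure, AddMonoidHom.add_apply,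
      LD.b_apply, h1, AddMonoidHom.zero_apply, AddMonoidHom.neg_apply]
    rw [huw]
    simp only [map_add, map_neg, AddMonoidHom.add_apply, AddMonoidHom.neg_apply, h3, D.alt]
    ring
  · simp only [LN.mul_z, LN.mul_m, LN.mul_v, LN.inv_v, LN.inv_m, LN.inv_z, LN.pure,
      AddMonoidHom.add_apply,
      LD.b_apply, h1, h2, AddMonoidHom.zero_apply, AddMonoidHom.neg_apply]
    rw [huw]
    simp only [map_add, map_neg, AddMonoidHom.add_apply, AddMonoidHom.neg_apply, h3, h4, D.alt]
    ring

theorem RR_nat (a : ℕ) (h : a % 3 ^ 15 = 0) : (a : RR) = 0 := by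
  have := RR_zero a (by exact_mod_cast congrArg (Nat.cast : ℕ → ℤ) h)
  exact_mod_cast this

theorem pN_rel' (i j y : Fin 8) (A B C : ℕ) (r : Fin 4) (hAB : (B * A) % 3 ^ 15 = 0)
    (hr : A • tE j + B • tE i - (3 * C) • tE y = tRR r) :
    pN (tE j) ^ A * pN (tE i) ^ B * (pN (tE y) ^ (3 * C))⁻¹ = 1 := by
  rw [pN_pow, pN_pow, pN_pow]
  have h : LN.pure tLD (A • tE j) * LN.pure tLD (B • tE i) *
      (LN.pure tLD ((3 * C) • tE y))⁻¹ ∈ LN.C tLD := by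
    refine LN.rel_mem _ _ _ (C • tE y) (fun x => ?_) ?_ (by rw [mul_smul])
    · rw [map_nsmul, map_nsmul, AddMonoidHom.nsmul_apply, AddMonoidHom.nsmul_apply,
        AddMonoidHom.nsmul_apply, smul_smul, nsmul_eq_mul, RR_nat _ hAB, zero_mul]
    · rw [hr]; exact AddSubgroup.subset_closure ⟨r, rfl⟩
  have h' := (QuotientGroup.eq_one_iff (N := LN.C tLD) _).2 h
  exact h'

theorem tR_coef : ∀ k : Fin 4, ∀ l : Fin 8,
    (((3 ^ (12 - ((pairIdx k).1 : ℕ)) : ℕ) : ℤ) * (if l = iE (pairIdx k).2 then 1 else 0)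
      + ((3 ^ (12 - ((pairIdx k).2 : ℕ)) : ℕ) : ℤ) * (if l = iE (pairIdx k).1 then 1 else 0)
      - ((3 ^ (12 - 2 * ((pairIdx k).1 : ℕ) - 2 * ((pairIdx k).2 : ℕ)) : ℕ) : ℤ) *
        (if l = iY k then 1 else 0) : ℤ) = 9 * tR k l := by decide +kernel

theorem pN_rel (k : Fin 4) :
    pN (tE (iE (pairIdx k).2)) ^ (3 ^ (12 - ((pairIdx k).1 : ℕ)))
      * pN (tE (iE (pairIdx k).1)) ^ (3 ^ (12 - ((pairIdx k).2 : ℕ)))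
      * (pN (tE (iY k)) ^ (3 ^ (12 - 2 * ((pairIdx k).1 : ℕ) - 2 * ((pairIdx k).2 : ℕ))))⁻¹ = 1 := by
  have e : (3 : ℕ) ^ (12 - 2 * ((pairIdx k).1 : ℕ) - 2 * ((pairIdx k).2 : ℕ)) =
      3 * 3 ^ (11 - 2 * ((pairIdx k).1 : ℕ) - 2 * ((pairIdx k).2 : ℕ)) := by
    fin_cases k <;> simp [pairIdx]
  rw [e]
  refine pN_rel' _ _ _ _ _ _ k ?_ ?_
  · fin_cases k <;> simp [pairIdx]
  · funext l
    rw [← e]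
    have h := congrArg (Int.cast : ℤ → RR) (tR_coef k l)
    simp only [tRR, ← h, Pi.sub_apply, Pi.add_apply, Pi.smul_apply, tE, Pi.single_apply]
    simp only [nsmul_eq_mul]
    push_cast
    rfl

end Conc


section Shift

variable {N : Type} [Group N]

/-- pointwise left multiplication -/
def shF : (ℤ → N) →* Equiv.Perm (ℤ × N) where
  toFun g := 
    { toFun := fun p => (p.1, g p.1 * p.2)
      invFun := fun p => (p.1, (g p.1)⁻¹ * p.2)
      left_inv := fun p => by simp
      right_inv := fun p => by simp }
  map_one' := by ext p <;> simp
  map_mul' g h := by ext p <;> simp [mul_assoc]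

theorem shF_apply (g : ℤ → N) (p : ℤ × N) : shF g p = (p.1, g p.1 * p.2) := rfl

theorem shF_inj (g : ℤ → N) (h : shF g = 1) : g = 1 := by
  funext n
  have := congrArg (fun f : Equiv.Perm (ℤ × N) => (f (n, 1)).2) h
  simpa [shF_apply] using this

/-- the shift -/
def shS : Equiv.Perm (ℤ × N) where
  toFun p := (p.1 - 1, p.2)
  invFun p := (p.1 + 1, p.2)
  left_inv p := by simp
  right_inv p := by simp

theorem shS_conj (g : ℤ → N) : shS * shF g * shS⁻¹ = shF (fun n => g (n + 1)) := by
  rw [mul_inv_eq_iff_eq_mul]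
  apply Equiv.ext
  rintro ⟨n, x⟩
  change (n - 1, g n * x) = (n - 1, g (n - 1 + 1) * x)
  rw [sub_add_cancel]

theorem shS_conj' (g : ℤ → N) : shS⁻¹ * shF g * shS = shF (fun n => g (n - 1)) := by
  rw [mul_assoc, inv_mul_eq_iff_eq_mul]
  apply Equiv.ext
  rintro ⟨n, x⟩
  rfl

theorem shS_comm (g : ℤ → N) : ⁅(shS : Equiv.Perm (ℤ × N)), shF g⁆ = shF (fun n => g (n + 1) * (g n)⁻¹) := by
  rw [commutatorElement_def, shS_conj, ← map_inv, ← map_mul]; rfl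

variable {Bf : ℕ → Subgroup N}

/-- pointwise filtration -/
def shB (Bf : ℕ → Subgroup N) (k : ℕ) : Subgroup (Equiv.Perm (ℤ × N)) :=
  (Subgroup.pi Set.univ (fun _ => Bf k)).map shF

theorem shB_mem (g : ℤ → N) (k : ℕ) (h : ∀ n, g n ∈ Bf k) : shF g ∈ shB Bf k :=
  ⟨g, fun n _ => h n, rfl⟩

theorem shB_elim (x : Equiv.Perm (ℤ × N)) (k : ℕ) (h : x ∈ shB Bf k) :
    ∃ g : ℤ → N, (∀ n, g n ∈ Bf k) ∧ shF g = x := by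
  obtain ⟨g, hg, rfl⟩ := h
  exact ⟨g, fun n => hg n trivial, rfl⟩

theorem shB_anti (hA : Antitone Bf) : Antitone (shB Bf) := by
  intro k l hkl x hx
  obtain ⟨g, hg, rfl⟩ := shB_elim x l hx
  exact shB_mem g k fun n => hA hkl (hg n)

theorem shB_comm (hB : ∀ i j x y, x ∈ Bf i → y ∈ Bf j → ⁅x, y⁆ ∈ Bf (i + j)) :
    ∀ i j x y, x ∈ shB Bf i → y ∈ shB Bf j → ⁅x, y⁆ ∈ shB Bf (i + j) := by
  intro i j x y hx hy
  obtain ⟨g, hg, rfl⟩ := shB_elim x i hx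
  obtain ⟨h, hh, rfl⟩ := shB_elim y j hy
  rw [← map_commutatorElement]
  exact shB_mem _ _ fun n => hB i j _ _ (hg n) (hh n)

variable (hA : Antitone Bf) (hB : ∀ i j x y, x ∈ Bf i → y ∈ Bf j → ⁅x, y⁆ ∈ Bf (i + j))

/-- polynomial sequences -/
def shP (k : ℕ) : Subgroup (Equiv.Perm (ℤ × N)) :=
  leibP shS (shB Bf) (shB_anti hA) (shB_comm hB) k

theorem shP_step (k : ℕ) (g : Equiv.Perm (ℤ × N)) (h1 : g ∈ shB Bf k)
    (h2 : ⁅(shS : Equiv.Perm (ℤ × N)), g⁆ ∈ shP hA hB (k + 1)) : g ∈ shP hA hB k := by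
  intro r
  cases r with
  | zero => exact h1
  | succ r => exact ⟨h1, h2 r⟩

theorem shP_const (k : ℕ) (x : N) (hx : x ∈ Bf k) : shF (fun _ => x) ∈ shP hA hB k := by
  refine shP_step hA hB k _ (shB_mem _ _ fun _ => hx) ?_
  rw [shS_comm]
  have : (fun _ : ℤ => x * x⁻¹) = 1 := by funext n; simp
  rw [this, map_one]
  exact Subgroup.one_mem _

theorem shS_lin (x : N) : ⁅(shS : Equiv.Perm (ℤ × N)), shF (fun n : ℤ => x ^ n)⁆ = shF (fun _ => x) := by
  rw [shS_comm]
  congr 1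
  funext n
  rw [zpow_add_one, ← (Commute.refl x).zpow_right n |>.eq, mul_inv_cancel_right]

theorem shP_lin (k : ℕ) (x : N) (hx : x ∈ Bf (k + 1)) :
    shF (fun n : ℤ => x ^ n) ∈ shP hA hB k := by
  refine shP_step hA hB k _ (shB_mem _ _ fun n => ?_) ?_
  · exact Subgroup.zpow_mem _ (hA (Nat.le_succ k) hx) n
  · rw [shS_lin]
    exact shP_const hA hB _ x hx

theorem shS_quad (x : N) : ⁅(shS : Equiv.Perm (ℤ × N)), shF (fun n : ℤ => x ^ (-(n * (n - 1) / 2)))⁆ =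
    shF (fun n => x⁻¹ ^ n) := by
  rw [shS_comm]
  congr 1
  funext n
  rw [inv_zpow', ← zpow_neg, ← zpow_add]
  congr 1
  have h : (n + 1) * (n + 1 - 1) = n * (n - 1) + n * 2 := by ring
  rw [h, Int.add_mul_ediv_right _ _ two_ne_zero]
  ring

theorem shP_quad (k : ℕ) (x : N) (hx : x ∈ Bf (k + 2)) :
    shF (fun n : ℤ => x ^ (-(n * (n - 1) / 2))) ∈ shP hA hB k := by
  refine shP_step hA hB k _ (shB_mem _ _ fun n => ?_) ?_
  · exact Subgroup.zpow_mem _ (hA (by omega) hx) _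
  · rw [shS_quad]
    exact shP_lin hA hB (k + 1) _ (Subgroup.inv_mem _ hx)

theorem shS_quad2 (x : N) : ⁅⁅(shS : Equiv.Perm (ℤ × N)), shF (fun n : ℤ => x ^ (-(n * (n - 1) / 2)))⁆, (shS : Equiv.Perm (ℤ × N))⁆ =
    shF (fun _ => x) := by
  rw [shS_quad, ← commutatorElement_inv, shS_lin, ← map_inv]
  congr 1
  funext n
  simp

end Shift

section NonMem

/-- images of the generators -/
def tgen : TGen → Equiv.Perm (ℤ × NN)
  | Sum.inl i => shF (fun _ => pN (tE (iE i)))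
  | Sum.inr (Sum.inl (i, j)) => if j = 0 then shS else
      shF (fun n : ℤ => (pN (tE (iE i)) ^ (3 ^ (2 * (i : ℕ)))) ^ n)
  | Sum.inr (Sum.inr (k, j)) => if j = 1 then
      shF (fun n : ℤ => pN (tE (iY k)) ^ (-(n * (n - 1) / 2))) else shS

theorem tgen_e (i : Fin 4) : FreeGroup.lift tgen (eF i) = shF (fun _ => pN (tE (iE i))) := by
  rw [eF, FreeGroup.lift_apply_of]; rfl

theorem tgen_y (i : Fin 4) : FreeGroup.lift tgen (yF i) =
    shF (fun _ => pN (tE (iE i)) ^ (3 ^ (2 * (i : ℕ)))) := by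
  rw [yF, map_commutatorElement, FreeGroup.lift_apply_of, FreeGroup.lift_apply_of]
  exact shS_lin _

theorem tgen_yy (k : Fin 4) : FreeGroup.lift tgen (yyF k) = shF (fun _ => pN (tE (iY k))) := by
  rw [yyF, map_commutatorElement, map_commutatorElement, FreeGroup.lift_apply_of,
    FreeGroup.lift_apply_of, FreeGroup.lift_apply_of]
  exact shS_quad2 _

theorem tgen_rel : ∀ w ∈ tRels, FreeGroup.lift tgen w = 1 := by
  rintro w (⟨i, rfl⟩ | ⟨k, rfl⟩)
  · rw [map_mul, map_pow, map_inv, tgen_e, tgen_y, ← map_pow]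
    exact mul_inv_cancel _
  · rw [map_mul, map_mul, map_pow, map_pow, map_inv, map_pow, tgen_e, tgen_e, tgen_yy,
      ← map_pow, ← map_pow, ← map_pow, ← map_inv, ← map_mul, ← map_mul]
    rw [← map_one shF]
    congr 1
    funext n
    exact pN_rel k

/-- the representation -/
def tphi : TGrp →* Equiv.Perm (ℤ × NN) := PresentedGroup.toGroup tgen_rel

theorem tphi_of (x : TGen) : tphi (PresentedGroup.of x) = tgen x := PresentedGroup.toGroup.of tgen_rel

theorem omega_not_mem : (⁅⁅eT 2, eT 1⁆, eT 0⁆ ^ (3 ^ 9)) ∉ gammaGrp TGrp 7 := by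
  intro h
  have key := leib_lcs (shB_anti NB_anti) (shB_comm NB_comm) (s := shS) (by
      intro k x hx
      obtain ⟨g, hg, rfl⟩ := shB_elim x k hx
      rw [shS_conj']
      exact shB_mem _ _ fun n => hg _) tphi (Set.range (PresentedGroup.of (rels := tRels)))
      (PresentedGroup.closure_range_of tRels) (by
      rintro _ ⟨x, rfl⟩
      rw [tphi_of]
      match x with
      | Sum.inl i => exact Or.inr (shP_const NB_anti NB_comm 1 _ (pN_one _))
      | Sum.inr (Sum.inl (i, j)) =>
        rw [tgen]
        split_ifs
        · exact Or.inl rfl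
        · exact Or.inr (shP_lin NB_anti NB_comm 1 _ (pN_two i))
      | Sum.inr (Sum.inr (k, j)) =>
        rw [tgen]
        split_ifs
        · exact Or.inr (shP_quad NB_anti NB_comm 1 _ (pN_three k))
        · exact Or.inl rfl) 5 _ h
  have e : ∀ i, tphi (eT i) = shF (fun _ => pN (tE (iE i))) := fun i => tphi_of _
  rw [map_pow, map_commutatorElement, map_commutatorElement, e, e, e,
    ← map_commutatorElement, ← map_commutatorElement, ← map_pow] at key
  obtain ⟨g, hg, hg'⟩ := shB_elim _ _ key
  have hg1 : g = 1 := by funext n; exact NB_seven _ (hg n)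
  rw [hg1, map_one] at hg'
  have h2 := congrFun (shF_inj _ hg'.symm) 0
  exact pN_omega h2

end NonMem


section Filt

theorem lcs_comm {G : Type*} [Group G] (j : ℕ) : ∀ i : ℕ,
    ⁅Subgroup.lowerCentralSeries (⊤ : Subgroup G) i,
      Subgroup.lowerCentralSeries (⊤ : Subgroup G) j⁆ ≤
      Subgroup.lowerCentralSeries (⊤ : Subgroup G) (i + j + 1) := by
  induction j with
  | zero => intro i; exact le_rfl
  | succ j ih =>
    intro i
    set L := Subgroup.lowerCentralSeries (⊤ : Subgroup G) with hL
    have hs : ∀ n, L (n + 1) = ⁅L n, ⊤⁆ := fun n => rfl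
    have hk : ∀ K : Subgroup G, K.map (QuotientGroup.mk' (L (i + (j + 1) + 1))) = ⊥ ↔
        K ≤ L (i + (j + 1) + 1) := by
      intro K
      rw [Subgroup.map_eq_bot_iff, QuotientGroup.ker_mk']
    rw [Subgroup.commutator_comm, hs j, ← hk, Subgroup.map_commutator, Subgroup.map_commutator]
    apply Subgroup.commutator_commutator_eq_bot_of_rotate
    · rw [← Subgroup.map_commutator, ← Subgroup.map_commutator, hk, Subgroup.commutator_comm ⊤,
        ← hs i]
      exact (ih (i + 1)).trans (le_of_eq (congrArg L (by omega)))
    · rw [← Subgroup.map_commutator, ← Subgroup.map_commutator, hk]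
      exact Subgroup.commutator_mono (ih i) le_rfl

/-- strongly central filtrations -/
structure Filt {H : Type*} [Group H] (A : ℕ → Subgroup H) : Prop where
  anti : Antitone A
  comm : ∀ {i j x y}, x ∈ A i → y ∈ A j → ⁅x, y⁆ ∈ A (i + j)
  top : ∀ x, x ∈ A 1
  normal : ∀ k, (A k).Normal

theorem filt_gamma (G : Type*) [Group G] : Filt (gammaGrp G) where
  anti := fun i j h => Subgroup.lowerCentralSeries_antitone _ (by omega)
  comm := by
    intro i j x y hx hy
    have h := lcs_comm (j - 1) (i - 1) (Subgroup.commutator_mem_commutator hx hy)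
    exact Subgroup.lowerCentralSeries_antitone _ (by omega) h
  top := fun x => trivial
  normal := fun k => by unfold gammaGrp; infer_instance

variable {Q : Type*} [Group Q]

theorem qf_mul {x1 x2 x3 x4 : Q} (h12 : Commute x1 x2) (h13 : Commute x1 x3) (h14 : Commute x1 x4)
    (h23 : Commute x2 x3) (h24 : Commute x2 x4) (h34 : Commute x3 x4) (a b c d a' b' c' d' : ℕ) :
    (x1 ^ a * x2 ^ b * x3 ^ c * x4 ^ d) * (x1 ^ a' * x2 ^ b' * x3 ^ c' * x4 ^ d') =
      x1 ^ (a + a') * x2 ^ (b + b') * x3 ^ (c + c') * x4 ^ (d + d') := by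
  have e4 : Commute (x4 ^ d) (x1 ^ a' * x2 ^ b' * x3 ^ c') :=
    ((h14.symm.pow_pow _ _).mul_right (h24.symm.pow_pow _ _)).mul_right (h34.symm.pow_pow _ _)
  have e3 : Commute (x3 ^ c) (x1 ^ a' * x2 ^ b') :=
    (h13.symm.pow_pow _ _).mul_right (h23.symm.pow_pow _ _)
  have e2 : Commute (x2 ^ b) (x1 ^ a') := h12.symm.pow_pow _ _
  rw [e4.mul_mul_mul_comm, e3.mul_mul_mul_comm, e2.mul_mul_mul_comm, ← pow_add, ← pow_add,
    ← pow_add, ← pow_add]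

theorem qf_pow {x1 x2 x3 x4 : Q} (h12 : Commute x1 x2) (h13 : Commute x1 x3) (h14 : Commute x1 x4)
    (h23 : Commute x2 x3) (h24 : Commute x2 x4) (h34 : Commute x3 x4) (a b c d m : ℕ) :
    (x1 ^ a * x2 ^ b * x3 ^ c * x4 ^ d) ^ m =
      x1 ^ (a * m) * x2 ^ (b * m) * x3 ^ (c * m) * x4 ^ (d * m) := by
  induction m with
  | zero => simp
  | succ m ih => rw [pow_succ, ih, qf_mul h12 h13 h14 h23 h24 h34]; simp only [mul_add, mul_one]

theorem qt {g x x1 x2 x3 x4 : Q} (h1 : ⁅g, x⁆ = x1) (h2 : ⁅g, x1⁆ = x2) (h3 : ⁅g, x2⁆ = x3)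
    (h4 : ⁅g, x3⁆ = x4) (h5 : ⁅g, x4⁆ = 1)
    (h12 : Commute x1 x2) (h13 : Commute x1 x3) (h14 : Commute x1 x4)
    (h23 : Commute x2 x3) (h24 : Commute x2 x4) (h34 : Commute x3 x4) (k : ℕ) :
    ⁅g ^ k, x⁆ = x1 ^ k * x2 ^ (k.choose 2) * x3 ^ (k.choose 3) * x4 ^ (k.choose 4) := by
  induction k with
  | zero => simp
  | succ k ih =>
    have e : ⁅g ^ (k + 1), x⁆ = MulAut.conj g ⁅g ^ k, x⁆ * ⁅g, x⁆ := by
      rw [pow_succ', MulAut.conj_apply]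
      simp only [commutatorElement_def]; group
    have hc : ∀ y z : Q, ⁅g, y⁆ = z → MulAut.conj g y = z * y := by
      rintro y z rfl
      rw [MulAut.conj_apply]; simp only [commutatorElement_def]; group
    have f1 : MulAut.conj g x1 = x1 ^ 1 * x2 ^ 1 * x3 ^ 0 * x4 ^ 0 := by
      rw [hc _ _ h2, ← h12.eq]; simp
    have f2 : MulAut.conj g x2 = x1 ^ 0 * x2 ^ 1 * x3 ^ 1 * x4 ^ 0 := by
      rw [hc _ _ h3, ← h23.eq]; simp
    have f3 : MulAut.conj g x3 = x1 ^ 0 * x2 ^ 0 * x3 ^ 1 * x4 ^ 1 := by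
      rw [hc _ _ h4, ← h34.eq]; simp
    have f4 : MulAut.conj g x4 = x1 ^ 0 * x2 ^ 0 * x3 ^ 0 * x4 ^ 1 := by
      rw [hc _ _ h5]; simp
    have f0 : x1 = x1 ^ 1 * x2 ^ 0 * x3 ^ 0 * x4 ^ 0 := by simp
    rw [e, ih, h1.trans f0]
    simp only [map_mul, map_pow]
    rw [f1, f2, f3, f4]
    simp only [qf_pow h12 h13 h14 h23 h24 h34, qf_mul h12 h13 h14 h23 h24 h34]
    have c2 : (k + 1).choose 2 = k + k.choose 2 := by
      rw [Nat.choose_succ_succ' k 1, Nat.choose_one_right]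
    have c3 : (k + 1).choose 3 = k.choose 2 + k.choose 3 := Nat.choose_succ_succ' k 2
    have c4 : (k + 1).choose 4 = k.choose 3 + k.choose 4 := Nat.choose_succ_succ' k 3
    rw [c2, c3, c4]
    simp only [one_mul, zero_mul, add_zero, zero_add]

theorem qt_pow {g x x1 x2 x3 x4 : Q} (h1 : ⁅g, x⁆ = x1) (h2 : ⁅g, x1⁆ = x2) (h3 : ⁅g, x2⁆ = x3)
    (h4 : ⁅g, x3⁆ = x4) (h5 : ⁅g, x4⁆ = 1)
    (h12 : Commute x1 x2) (h13 : Commute x1 x3) (h14 : Commute x1 x4)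
    (h23 : Commute x2 x3) (h24 : Commute x2 x4) (h34 : Commute x3 x4) (k m : ℕ)
    (e2 : x2 ^ (k.choose 2 * m) = 1) (e3 : x3 ^ (k.choose 3 * m) = 1)
    (e4 : x4 ^ (k.choose 4 * m) = 1) : ⁅g ^ k, x⁆ ^ m = x1 ^ (k * m) := by
  rw [qt h1 h2 h3 h4 h5 h12 h13 h14 h23 h24 h34, qf_pow h12 h13 h14 h23 h24 h34, e2, e3, e4]
  simp

variable {A : ℕ → Subgroup Q}

theorem Filt.commute (hA : Filt A) (n : ℕ) [(A n).Normal] {i j : ℕ} {x y : Q} (hx : x ∈ A i)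
    (hy : y ∈ A j) (h : n ≤ i + j) : Commute (QuotientGroup.mk' (A n) x) (QuotientGroup.mk' (A n) y) := by
  rw [commute_iff_eq, ← commutatorElement_eq_one_iff_mul_comm, ← map_commutatorElement]
  exact (QuotientGroup.eq_one_iff _).2 (hA.anti h (hA.comm hx hy))

theorem mk_one (n : ℕ) [(A n).Normal] (x : Q) : QuotientGroup.mk' (A n) x = 1 ↔ x ∈ A n :=
  QuotientGroup.eq_one_iff x

theorem Filt.tt (hA : Filt A) (n : ℕ) {i j k m : ℕ} {g x : Q} (hg : g ∈ A i) (hx : x ∈ A j)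
    (hn1 : n ≤ 3 * i + 2 * j) (hn2 : n ≤ 5 * i + j)
    (e2 : ⁅g, ⁅g, x⁆⁆ ^ (k.choose 2 * m) ∈ A n) (e3 : ⁅g, ⁅g, ⁅g, x⁆⁆⁆ ^ (k.choose 3 * m) ∈ A n)
    (e4 : ⁅g, ⁅g, ⁅g, ⁅g, x⁆⁆⁆⁆ ^ (k.choose 4 * m) ∈ A n) :
    ⁅g ^ k, x⁆ ^ m ∈ A n ↔ ⁅g, x⁆ ^ (k * m) ∈ A n := by
  haveI := hA.normal n
  have m1 := hA.comm hg hx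
  have m2 := hA.comm hg m1
  have m3 := hA.comm hg m2
  have m4 := hA.comm hg m3
  have m5 := hA.comm hg m4
  rw [← mk_one n] at e2 e3 e4
  rw [map_pow] at e2 e3 e4
  have key := qt_pow (g := QuotientGroup.mk' (A n) g) (x := QuotientGroup.mk' (A n) x)
    (map_commutatorElement _ g x).symm (map_commutatorElement _ g _).symm
    (map_commutatorElement _ g _).symm (map_commutatorElement _ g _).symm
    (by rw [← map_commutatorElement, mk_one]; exact hA.anti (by omega) m5)
    (hA.commute n m1 m2 (by omega)) (hA.commute n m1 m3 (by omega)) (hA.commute n m1 m4 (by omega))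
    (hA.commute n m2 m3 (by omega)) (hA.commute n m2 m4 (by omega)) (hA.commute n m3 m4 (by omega))
    k m e2 e3 e4
  rw [← mk_one n, ← mk_one n (⁅g, x⁆ ^ _), map_pow, map_pow, map_commutatorElement, map_pow, key,
    map_commutatorElement]

theorem Filt.p1 (hA : Filt A) (n : ℕ) {i j m : ℕ} {g x : Q} (hg : g ∈ A i) (hx : x ∈ A j)
    (hn : n ≤ 2 * i + j) : ⁅g ^ m, x⁆ ∈ A n ↔ ⁅g, x⁆ ^ m ∈ A n := by
  have m2 := hA.comm hg (hA.comm hg hx)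
  have m3 := hA.comm hg m2
  have m4 := hA.comm hg m3
  have := hA.tt n (m := 1) (k := m) hg hx (by omega) (by omega)
    (Subgroup.pow_mem _ (hA.anti (by omega) m2) _) (Subgroup.pow_mem _ (hA.anti (by omega) m3) _)
    (Subgroup.pow_mem _ (hA.anti (by omega) m4) _)
  rwa [pow_one, mul_one] at this

theorem Filt.p2 (hA : Filt A) (n : ℕ) {i j m : ℕ} {g x : Q} (hg : g ∈ A i) (hx : x ∈ A j)
    (hn : n ≤ i + 2 * j) : ⁅g, x ^ m⁆ ∈ A n ↔ ⁅g, x⁆ ^ m ∈ A n := by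
  have := hA.p1 n (m := m) hx hg (by omega)
  rw [← commutatorElement_inv, ← commutatorElement_inv x g, inv_pow, inv_mem_iff, inv_mem_iff]
  exact this

/-- P1 / P2 with torsion input -/
theorem Filt.q1 (hA : Filt A) (n : ℕ) {i j l m : ℕ} {g x : Q} (hg : g ∈ A i) (hx : x ∈ A j)
    (hgm : g ^ m ∈ A l) (hn : n ≤ 2 * i + j) (hl : n ≤ l + j) : ⁅g, x⁆ ^ m ∈ A n :=
  (hA.p1 n hg hx hn).1 (hA.anti hl (hA.comm hgm hx))

theorem Filt.q2 (hA : Filt A) (n : ℕ) {i j l m : ℕ} {g x : Q} (hg : g ∈ A i) (hx : x ∈ A j)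
    (hgm : x ^ m ∈ A l) (hn : n ≤ i + 2 * j) (hl : n ≤ i + l) : ⁅g, x⁆ ^ m ∈ A n :=
  (hA.p2 n hg hx hn).1 (hA.anti hl (hA.comm hg hgm))

theorem pow_dvd_mem {A : Subgroup Q} {x : Q} {k l : ℕ} (h : x ^ k ∈ A) (hd : k ∣ l) :
    x ^ l ∈ A := by
  obtain ⟨q, rfl⟩ := hd
  rw [pow_mul]; exact Subgroup.pow_mem _ h q

theorem choose_dvd (e j : ℕ) (hj : j = 2 ∨ j = 3 ∨ j = 4) :
    3 ^ e ∣ (3 ^ (e + 1)).choose j := by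
  obtain ⟨i, rfl⟩ : ∃ i, j = i + 1 := ⟨j - 1, by omega⟩
  obtain ⟨N, hN⟩ : ∃ N, 3 ^ (e + 1) = N + 1 := ⟨3 ^ (e + 1) - 1, by
    have : 0 < 3 ^ (e + 1) := by positivity
    omega⟩
  have h := Nat.add_one_mul_choose_eq N i
  rw [← hN] at h
  have h1 : 3 ^ (e + 1) ∣ (3 ^ (e + 1)).choose (i + 1) * (i + 1) := ⟨_, h.symm⟩
  have h2 : 3 ^ e ∣ (3 ^ (e + 1)).choose (i + 1) * (i + 1) := (pow_dvd_pow 3 (Nat.le_succ e)).trans h1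
  rcases hj with hj | hj | hj
  · rw [hj] at h2 ⊢
    exact (Nat.Coprime.pow_left e (by norm_num)).dvd_of_dvd_mul_right h2
  · rw [hj] at h1 ⊢
    rw [pow_succ] at h1
    rw [pow_succ]
    exact Nat.dvd_of_mul_dvd_mul_right (by norm_num) h1
  · rw [hj] at h2 ⊢
    exact (Nat.Coprime.pow_left e (by norm_num)).dvd_of_dvd_mul_right h2

end Filt


section Mem

variable {Q : Type*} [Group Q] {A : ℕ → Subgroup Q}

theorem Filt.p1eq (hA : Filt A) (n : ℕ) [(A n).Normal] {i j m : ℕ} {g x : Q} (hg : g ∈ A i)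
    (hx : x ∈ A j) (hn : n ≤ 2 * i + j) :
    QuotientGroup.mk' (A n) ⁅g ^ m, x⁆ = QuotientGroup.mk' (A n) ⁅g, x⁆ ^ m := by
  have h2 : ⁅QuotientGroup.mk' (A n) g, QuotientGroup.mk' (A n) ⁅g, x⁆⁆ = 1 := by
    rw [← map_commutatorElement, mk_one]
    exact hA.anti (by omega) (hA.comm hg (hA.comm hg hx))
  have h1 : ⁅QuotientGroup.mk' (A n) g, (1 : Q ⧸ A n)⁆ = 1 := commutatorElement_one_right _
  have c1 : ∀ y : Q ⧸ A n, Commute y 1 := fun y => Commute.one_right y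
  have := qt (map_commutatorElement (QuotientGroup.mk' (A n)) g x).symm h2 h1 h1 h1
    (c1 _) (c1 _) (c1 _) (c1 _) (c1 _) (c1 _) m
  rw [map_commutatorElement, map_pow, this]
  simp

theorem Filt.s1 (hA : Filt A) {a b : Q} (ha : a ^ 81 ∈ A 2) (hb : b ^ 9 ∈ A 2) :
    ⁅b, a⁆ ∈ A 2 ∧ ⁅b, a⁆ ^ 9 ∈ A 3 ∧ ⁅b, a⁆ ^ 729 ∈ A 4 := by
  have m1 : ⁅b, a⁆ ∈ A 2 := hA.comm (hA.top b) (hA.top a)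
  have m2 : ⁅b, ⁅b, a⁆⁆ ∈ A 3 := hA.comm (hA.top b) m1
  have m3 : ⁅b, ⁅b, ⁅b, a⁆⁆⁆ ∈ A 4 := hA.comm (hA.top b) m2
  have m4 : ⁅b, ⁅b, ⁅b, ⁅b, a⁆⁆⁆⁆ ∈ A 5 := hA.comm (hA.top b) m3
  have h9 : ⁅b, a⁆ ^ 9 ∈ A 3 := hA.q1 3 (hA.top b) (hA.top a) hb (by omega) (by omega)
  refine ⟨m1, h9, ?_⟩
  have h := (hA.tt 4 (k := 9) (m := 81) (hA.top b) (hA.top a) (by omega) (by omega)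
    (pow_dvd_mem (hA.q2 4 (hA.top b) m1 h9 (by omega) (by omega)) (by decide))
    (Subgroup.pow_mem _ m3 _) (Subgroup.pow_mem _ (hA.anti (by omega) m4) _)).1
    (hA.q2 4 hb (hA.top a) ha (by omega) (by omega))
  exact h

theorem Filt.s2 (hA : Filt A) {y w : Q} (hy : y ^ 81 ∈ A 2) (h1 : w ∈ A 2)
    (h3 : w ^ 729 ∈ A 4) : ⁅y, w⁆ ^ (3 ^ 10) ∈ A 6 := by
  have m1 : ⁅y, w⁆ ∈ A 3 := hA.comm (hA.top y) h1
  have m2 : ⁅y, ⁅y, w⁆⁆ ∈ A 4 := hA.comm (hA.top y) m1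
  have m3 : ⁅y, ⁅y, ⁅y, w⁆⁆⁆ ∈ A 5 := hA.comm (hA.top y) m2
  have m4 : ⁅y, ⁅y, ⁅y, ⁅y, w⁆⁆⁆⁆ ∈ A 6 := hA.comm (hA.top y) m3
  have b1 : ⁅y, w⁆ ^ 729 ∈ A 5 := hA.q2 5 (hA.top y) h1 h3 (by omega) (by omega)
  have b2 := hA.q2 6 (hA.top y) m1 b1 (by omega) (by omega)
  have b3 := hA.q2 6 (hA.top y) m2 b2 (by omega) (by omega)
  have h := (hA.tt 6 (k := 81) (m := 729) (hA.top y) h1 (by omega) (by omega)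
    (pow_dvd_mem b2 (Dvd.intro_left _ rfl)) (pow_dvd_mem b3 (Dvd.intro_left _ rfl))
    (Subgroup.pow_mem _ m4 _)).1 (hA.q2 6 hy h1 h3 (by omega) (by omega))
  have e : (3 : ℕ) ^ 10 = 81 * 729 := by norm_num
  rw [e]; exact h

theorem Filt.s2d (hA : Filt A) {y w : Q} (hy : y ^ 81 ∈ A 2) (h1 : w ∈ A 2)
    (h3 : w ^ 729 ∈ A 4) (x : Q) : ⁅x, ⁅y, w⁆⁆ ^ (3 ^ 10) ∈ A 7 :=
  hA.q2 7 (hA.top x) (hA.comm (hA.top y) h1) (hA.s2 hy h1 h3) (by omega) (by omega)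

theorem Filt.s3a (hA : Filt A) {y w : Q} (hy : y ∈ A 3) (h1 : w ∈ A 2)
    (h3 : w ^ 729 ∈ A 4) : ⁅y ^ (3 ^ 8), w⁆ ∈ A 7 := by
  rw [hA.p1 7 hy h1 (by omega)]
  have h : ⁅y, w⁆ ^ 729 ∈ A 7 := hA.q2 7 hy h1 h3 (by omega) (by omega)
  exact pow_dvd_mem h ⟨9, by norm_num⟩

theorem Filt.s3b (hA : Filt A) {a x : Q} (ha : a ^ 81 ∈ A 2) (hx : x ∈ A 4)
    (h5 : x ^ 81 ∈ A 5) : ⁅a, x⁆ ^ (3 ^ 8) ∈ A 7 := by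
  have m1 : ⁅a, x⁆ ∈ A 5 := hA.comm (hA.top a) hx
  have m2 : ⁅a, ⁅a, x⁆⁆ ∈ A 6 := hA.comm (hA.top a) m1
  have m3 : ⁅a, ⁅a, ⁅a, x⁆⁆⁆ ∈ A 7 := hA.comm (hA.top a) m2
  have m4 : ⁅a, ⁅a, ⁅a, ⁅a, x⁆⁆⁆⁆ ∈ A 8 := hA.comm (hA.top a) m3
  have b2 : ⁅a, ⁅a, x⁆⁆ ^ 81 ∈ A 7 := hA.q1 7 (hA.top a) m1 ha (by omega) (by omega)
  have h := (hA.tt 7 (k := 81) (m := 81) (hA.top a) hx (by omega) (by omega)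
    (pow_dvd_mem b2 (Dvd.intro_left _ rfl)) (Subgroup.pow_mem _ m3 _)
    (Subgroup.pow_mem _ (hA.anti (by omega) m4) _)).1 (hA.q2 7 ha hx h5 (by omega) (by omega))
  have e : (3 : ℕ) ^ 8 = 81 * 81 := by norm_num
  rw [e]; exact h

theorem Filt.s3c (hA : Filt A) {a y : Q} (ha : a ^ 81 ∈ A 2) (hy : y ∈ A 3) :
    ⁅⁅y ^ (3 ^ 8), a⁆, a⁆ ∈ A 7 := by
  have := hA.normal 7
  have m1 : ⁅y, a⁆ ∈ A 4 := hA.comm hy (hA.top a)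
  have h5 : ⁅y, a⁆ ^ 81 ∈ A 5 := hA.q2 5 hy (hA.top a) ha (by omega) (by omega)
  rw [← mk_one, map_commutatorElement, hA.p1eq 7 hy (hA.top a) (by omega), ← map_pow,
    ← map_commutatorElement, mk_one, hA.p1 7 m1 (hA.top a) (by omega), ← commutatorElement_inv,
    inv_pow, inv_mem_iff]
  exact hA.s3b ha m1 h5

theorem s4_aux {a B P u q r : Q} (h1 : B * u ^ 3 = r) (h2 : P * u = q) (hPa : Commute P a)
    (hPt : Commute P ⁅q, a⁆) (hqa : Commute ⁅q, a⁆ a) (hqq : Commute ⁅q, a⁆ q)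
    (hra : Commute ⁅r, a⁆ a) (hrq : Commute r ⁅q, a⁆) : Commute ⁅B, a⁆ a := by
  obtain ⟨t, ht⟩ : ∃ t, t = ⁅q, a⁆ := ⟨_, rfl⟩
  rw [← ht] at hPt hqa hqq hrq
  have hu : u = P⁻¹ * q := by rw [← h2, inv_mul_cancel_left]
  have hut : Commute u t := by rw [hu]; exact (hPt.inv_left).mul_left hqq.symm
  have hsc : ∀ x : Q, SemiconjBy x a (⁅x, a⁆ * a) := by
    intro x
    rw [SemiconjBy, commutatorElement_def]; group
  have hua : SemiconjBy u a (t * a) := by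
    rw [hu]
    have h3 : SemiconjBy q a (t * a) := ht ▸ hsc q
    have h4 : SemiconjBy P⁻¹ (t * a) (t * a) := (hPt.inv_left).mul_right hPa.inv_left
    exact h4.mul_left h3
  have hu3 : SemiconjBy (u ^ 3) (t⁻¹ ^ 3 * a) a := by
    have f : ∀ x y : Q, SemiconjBy u x y → SemiconjBy u (t⁻¹ * x) (t⁻¹ * y) :=
      fun x y h => SemiconjBy.mul_right hut.inv_right h
    have g0 := f _ _ hua
    rw [inv_mul_cancel_left] at g0
    have g1 := f _ _ g0
    have g2 := f _ _ g1
    have := (g0.mul_left g1).mul_left g2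
    have e1 : u ^ 3 = u * u * u := by rw [pow_succ, pow_two]
    have e2 : t⁻¹ ^ 3 * a = t⁻¹ * (t⁻¹ * (t⁻¹ * a)) := by group
    rw [e1, e2]; exact this
  have hu3' : SemiconjBy (u ^ 3)⁻¹ a (t⁻¹ ^ 3 * a) := hu3.inv_symm_left
  have hr : SemiconjBy r (t⁻¹ ^ 3 * a) (t⁻¹ ^ 3 * (⁅r, a⁆ * a)) :=
    SemiconjBy.mul_right (hrq.inv_right.pow_right 3) (hsc r)
  have hB : SemiconjBy B a (t⁻¹ ^ 3 * (⁅r, a⁆ * a)) := by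
    have e : B = r * (u ^ 3)⁻¹ := by rw [← h1, mul_inv_cancel_right]
    rw [e]; exact hr.mul_left hu3'
  have e : ⁅B, a⁆ = t⁻¹ ^ 3 * ⁅r, a⁆ := by
    rw [commutatorElement_def, hB.eq]; group
  rw [e]
  exact (hqa.inv_left.pow_left 3).mul_left hra

theorem mk_commute {n : ℕ} [(A n).Normal] {x y : Q} (h : ⁅x, y⁆ ∈ A n) :
    Commute (QuotientGroup.mk' (A n) x) (QuotientGroup.mk' (A n) y) := by
  rw [commute_iff_eq, ← commutatorElement_eq_one_iff_mul_comm, ← map_commutatorElement, mk_one]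
  exact h

theorem commute_mk {n : ℕ} [(A n).Normal] {x y : Q}
    (h : Commute (QuotientGroup.mk' (A n) x) (QuotientGroup.mk' (A n) y)) : ⁅x, y⁆ ∈ A n := by
  rw [commute_iff_eq, ← commutatorElement_eq_one_iff_mul_comm, ← map_commutatorElement,
    mk_one] at h
  exact h

theorem Filt.s4 (hA : Filt A) {a B u q r : Q} (n : ℕ) (ha : a ^ 81 ∈ A 2) (hq : q ∈ A 3)
    (hr : r ∈ A 3) (h1 : B * u ^ 3 = r ^ (3 ^ 8)) (h2 : a ^ n * u = q ^ (3 ^ 8)) :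
    ⁅⁅B, a⁆, a⁆ ∈ A 7 := by
  have := hA.normal 7
  have mq : q ^ (3 ^ 8) ∈ A 3 := Subgroup.pow_mem _ hq _
  have mr : r ^ (3 ^ 8) ∈ A 3 := Subgroup.pow_mem _ hr _
  have cq := mk_commute (hA.s3c ha hq)
  have cr := mk_commute (hA.s3c ha hr)
  have mqa : ⁅q ^ (3 ^ 8), a⁆ ∈ A 4 := hA.comm mq (hA.top a)
  apply commute_mk
  have e1 := hA.commute 7 mqa mq (by omega)
  have e2 := hA.commute 7 mr mqa (by omega)
  rw [map_commutatorElement] at cq cr e1 e2 ⊢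
  refine s4_aux (P := QuotientGroup.mk' (A 7) a ^ n) (u := QuotientGroup.mk' (A 7) u)
    (by rw [← map_pow, ← map_mul, h1]) (by rw [← map_pow, ← map_mul, h2])
    ((Commute.refl _).pow_left n) (cq.symm.pow_left n) cq e1 cr e2

theorem Filt.s5 (hA : Filt A) {a y : Q} (k : ℕ) (hk : 81 ∣ k.choose 2) (ha : a ^ 81 ∈ A 2)
    (hy : y ∈ A 2) (h : ⁅⁅y ^ k, a⁆, a⁆ ∈ A 7) : ⁅⁅y, a⁆, a⁆ ^ k ∈ A 7 := by
  have := hA.normal 7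
  have m1 : ⁅y, a⁆ ∈ A 3 := hA.comm hy (hA.top a)
  have m2 : ⁅y, ⁅y, a⁆⁆ ∈ A 5 := hA.comm hy m1
  have m3 : ⁅y, ⁅y, ⁅y, a⁆⁆⁆ ∈ A 7 := hA.comm hy m2
  rw [← hA.p1 7 m1 (hA.top a) (by omega)]
  have c2 : ⁅⁅y, ⁅y, a⁆⁆ ^ (k.choose 2), a⁆ ∈ A 7 := by
    rw [hA.p1 7 m2 (hA.top a) (by omega)]
    have : ⁅⁅y, ⁅y, a⁆⁆, a⁆ ^ 81 ∈ A 7 := hA.q2 7 m2 (hA.top a) ha (by omega) (by omega)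
    exact pow_dvd_mem this hk
  have h1 : ⁅QuotientGroup.mk' (A 7) y, (1 : Q ⧸ A 7)⁆ = 1 := commutatorElement_one_right _
  have c1 : ∀ y : Q ⧸ A 7, Commute y 1 := fun y => Commute.one_right y
  have e := qt (map_commutatorElement (QuotientGroup.mk' (A 7)) y a).symm
    (map_commutatorElement (QuotientGroup.mk' (A 7)) y _).symm
    (by rw [← map_commutatorElement, mk_one]; exact m3) h1 h1
    (hA.commute 7 m1 m2 (by omega)) (c1 _) (c1 _) (c1 _) (c1 _) (c1 _) k
  rw [one_pow, one_pow, mul_one, mul_one] at e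
  have ca := mk_commute h
  have cb := mk_commute c2
  rw [map_commutatorElement, map_pow, e] at ca
  rw [map_pow] at cb
  apply commute_mk
  rw [map_pow]
  have := ca.mul_left cb.inv_left
  rwa [mul_inv_cancel_right] at this

/-- the torsion subgroup used in step six -/
def Filt.K (hA : Filt A) (k : ℕ) : Subgroup Q where
  carrier := {x | x ∈ A 4 ∧ x ^ k ∈ A 7}
  one_mem' := ⟨(A 4).one_mem, by rw [one_pow]; exact (A 7).one_mem⟩
  mul_mem' := by
    rintro x y ⟨h1, h2⟩ ⟨h3, h4⟩
    have := hA.normal 7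
    refine ⟨(A 4).mul_mem h1 h3, ?_⟩
    rw [← mk_one, map_pow, map_mul, (hA.commute 7 h1 h3 (by omega)).mul_pow, ← map_pow, ← map_pow,
      (mk_one _ _).2 h2, (mk_one _ _).2 h4, one_mul]
  inv_mem' := by
    rintro x ⟨h1, h2⟩
    exact ⟨(A 4).inv_mem h1, by rw [inv_pow]; exact (A 7).inv_mem h2⟩

theorem Filt.K_normal (hA : Filt A) (k : ℕ) : (hA.K k).Normal := ⟨by
  rintro x ⟨h1, h2⟩ g
  refine ⟨(hA.normal 4).conj_mem x h1 g, ?_⟩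
  rw [conj_pow]
  exact (hA.normal 7).conj_mem _ h2 g⟩

theorem Filt.s6 (hA : Filt A) {a b : Q} (ha : a ^ 81 ∈ A 2) (hb : b ^ 9 ∈ A 2)
    (h : ⁅⁅b ^ 9, a⁆, a⁆ ^ (3 ^ 10) ∈ A 7) : ⁅a, ⁅b, a⁆⁆ ^ (3 ^ 12) ∈ A 7 := by
  obtain ⟨w1, w2, w3⟩ := hA.s1 ha hb
  have hb81 : b ^ 81 ∈ A 2 := pow_dvd_mem hb (by norm_num)
  have := hA.normal 7
  have := hA.K_normal (3 ^ 10)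
  set K := hA.K (3 ^ 10) with hK
  have hcen : ∀ y, y ^ 81 ∈ A 2 → ∀ x, ⁅x, ⁅y, ⁅b, a⁆⁆⁆ ∈ K := fun y hy x =>
    ⟨hA.comm (hA.top x) (hA.comm (hA.top y) w1), hA.s2d hy w1 w3 x⟩
  set p := QuotientGroup.mk' K with hp
  have pk : ∀ x, p x = 1 ↔ x ∈ K := fun x => QuotientGroup.eq_one_iff x
  have hcen' : ∀ y, y ^ 81 ∈ A 2 → ∀ x, ⁅p x, ⁅p y, p ⁅b, a⁆⁆⁆ = 1 := fun y hy x => by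
    rw [← map_commutatorElement, ← map_commutatorElement, pk]; exact hcen y hy x
  have hcom : ∀ y, y ^ 81 ∈ A 2 → ∀ x, Commute (p x) ⁅p y, p ⁅b, a⁆⁆ := fun y hy x => by
    rw [commute_iff_eq, ← commutatorElement_eq_one_iff_mul_comm]; exact hcen' y hy x
  have h1 : ⁅p b, (1 : Q ⧸ K)⁆ = 1 := commutatorElement_one_right _
  have c1 : ∀ y : Q ⧸ K, Commute y 1 := fun y => Commute.one_right y
  have e := qt (map_commutatorElement p b a).symm rfl (hcen' b hb81 b) h1 h1
    (hcom b hb81 _) (c1 _) (c1 _) (c1 _) (c1 _) (c1 _) 9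
  rw [one_pow, one_pow, mul_one, mul_one] at e
  have e2 : ⁅⁅p b ^ 9, p a⁆, p a⁆ = ⁅p ⁅b, a⁆, p a⁆ ^ 9 := by
    rw [e]
    have hz : Commute (⁅p b, p ⁅b, a⁆⁆ ^ (Nat.choose 9 2)) (p a) := ((hcom b hb81 a).symm.pow_left _)
    obtain ⟨z, hz'⟩ : ∃ z, z = ⁅p b, p ⁅b, a⁆⁆ ^ (Nat.choose 9 2) := ⟨_, rfl⟩
    rw [← hz'] at hz ⊢
    have e3 : ⁅p ⁅b, a⁆ ^ 9 * z, p a⁆ = ⁅p ⁅b, a⁆ ^ 9, p a⁆ := by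
      have := hz.eq
      simp only [commutatorElement_def, mul_inv_rev]
      calc p (b * a * b⁻¹ * a⁻¹) ^ 9 * z * p a * (z⁻¹ * (p (b * a * b⁻¹ * a⁻¹) ^ 9)⁻¹) * (p a)⁻¹
          = p (b * a * b⁻¹ * a⁻¹) ^ 9 * (z * p a) * z⁻¹ * (p (b * a * b⁻¹ * a⁻¹) ^ 9)⁻¹ * (p a)⁻¹ := by
            simp only [mul_assoc]
        _ = _ := by rw [this]; simp only [mul_assoc, mul_inv_cancel_left]
    rw [e3]
    have hc : ⁅p ⁅b, a⁆, ⁅p ⁅b, a⁆, p a⁆⁆ = 1 := by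
      rw [commutatorElement_eq_one_iff_mul_comm, ← commutatorElement_inv (p a)]
      exact ((hcom a ha ⁅b, a⁆).inv_right).eq
    have h1 : ⁅p ⁅b, a⁆, (1 : Q ⧸ K)⁆ = 1 := commutatorElement_one_right _
    have e4 := qt rfl hc h1 h1 h1 (c1 _) (c1 _) (c1 _) (c1 _) (c1 _) (c1 _) 9
    rw [e4]; simp
  have e2' : p ⁅⁅b ^ 9, a⁆, a⁆ = p ⁅⁅b, a⁆, a⁆ ^ 9 := by
    rw [map_commutatorElement p ⁅b ^ 9, a⁆ a, map_commutatorElement p (b ^ 9) a, map_pow, e2,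
      map_commutatorElement p ⁅b, a⁆ a]
  have e5 : (⁅⁅b, a⁆, a⁆ ^ 9)⁻¹ * ⁅⁅b ^ 9, a⁆, a⁆ ∈ K := by
    rw [← pk, map_mul, map_inv, map_pow, e2', inv_mul_cancel]
  obtain ⟨κ, hκ⟩ : ∃ κ, κ = (⁅⁅b, a⁆, a⁆ ^ 9)⁻¹ * ⁅⁅b ^ 9, a⁆, a⁆ := ⟨_, rfl⟩
  rw [← hκ] at e5
  have e6 : ⁅⁅b ^ 9, a⁆, a⁆ = ⁅⁅b, a⁆, a⁆ ^ 9 * κ := by rw [hκ, mul_inv_cancel_left]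
  have m3 : ⁅⁅b, a⁆, a⁆ ∈ A 3 := hA.comm w1 (hA.top a)
  have cm := hA.commute 7 (Subgroup.pow_mem _ m3 9) e5.1 (by omega)
  have e7 : ⁅⁅b, a⁆, a⁆ ^ (3 ^ 12) ∈ A 7 := by
    rw [e6, ← mk_one, map_pow, map_mul, cm.mul_pow, ← map_pow _ κ, (mk_one _ _).2 e5.2, mul_one,
      ← map_pow, mk_one, ← pow_mul] at h
    have e8 : (3 : ℕ) ^ 12 = 9 * 3 ^ 10 := by norm_num
    rw [e8]; exact h
  rw [← commutatorElement_inv, inv_pow, inv_mem_iff]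
  exact e7

theorem Filt.s7 (hA : Filt A) {a b : Q} (ha : a ^ 81 ∈ A 2) (hb : b ^ 9 ∈ A 2)
    (h : ⁅a, ⁅b, a⁆⁆ ^ (3 ^ 12) ∈ A 7) : ⁅a ^ (3 ^ 12), ⁅b, a⁆⁆ ∈ A 7 := by
  obtain ⟨w1, w2, w3⟩ := hA.s1 ha hb
  have m1 : ⁅a, ⁅b, a⁆⁆ ∈ A 3 := hA.comm (hA.top a) w1
  have m2 := hA.comm (hA.top a) m1
  have m3 := hA.comm (hA.top a) m2
  have t2 := hA.s2d ha w1 w3 a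
  have t3 := hA.q2 7 (hA.top a) m2 t2 (by omega) (by omega)
  have t4 := hA.q2 7 (hA.top a) m3 t3 (by omega) (by omega)
  have hd : ∀ j, j = 2 ∨ j = 3 ∨ j = 4 → 3 ^ 10 ∣ (3 ^ 12).choose j * 1 := fun j hj => by
    rw [mul_one]
    exact (pow_dvd_pow 3 (by omega)).trans (choose_dvd 11 j hj)
  have := (hA.tt 7 (k := 3 ^ 12) (m := 1) (hA.top a) w1 (by omega) (by omega)
    (pow_dvd_mem t2 (hd 2 (by omega))) (pow_dvd_mem t3 (hd 3 (by omega)))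
    (pow_dvd_mem t4 (hd 4 (by omega)))).2 (by rw [mul_one]; exact h)
  rwa [pow_one] at this

theorem Filt.s8 (hA : Filt A) {a b e r q : Q} (ha : a ^ 81 ∈ A 2) (hb : b ^ 9 ∈ A 2)
    (he : e ∈ A 2) (hr : r ∈ A 3) (hq : q ∈ A 3)
    (h1 : b ^ (3 ^ 12) * e ^ (3 ^ 11) = r ^ (3 ^ 10))
    (h2 : a ^ (3 ^ 12) * e ^ (3 ^ 10) = q ^ (3 ^ 8)) :
    ⁅⁅a, b⁆, e⁆ ^ (3 ^ 10) ∈ A 7 := by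
  have := hA.normal 7
  obtain ⟨w1, w2, w3⟩ := hA.s1 ha hb
  have f4 : ⁅⁅b ^ (3 ^ 12), a⁆, a⁆ ∈ A 7 := by
    refine hA.s4 (3 ^ 12) (u := e ^ (3 ^ 10)) (r := r ^ 9) ha hq (Subgroup.pow_mem _ hr _) ?_ h2
    rw [← pow_mul, ← pow_mul]
    have e1 : (3 : ℕ) ^ 10 * 3 = 3 ^ 11 := (pow_succ 3 10).symm
    have e2 : (9 : ℕ) * 3 ^ 8 = 3 ^ 10 := by norm_num
    rw [e1, e2]; exact h1
  have f5 : ⁅⁅b ^ 9, a⁆, a⁆ ^ (3 ^ 10) ∈ A 7 := by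
    refine hA.s5 (3 ^ 10) ?_ ha hb ?_
    · exact (Dvd.intro (3 ^ 5) (by norm_num) : 81 ∣ 3 ^ 9).trans (choose_dvd 9 2 (by omega))
    · have e2 : (9 : ℕ) * 3 ^ 10 = 3 ^ 12 := by norm_num
      rw [← pow_mul, e2]; exact f4
  have f7 := hA.s7 ha hb (hA.s6 ha hb f5)
  have f3 := hA.s3a hq w1 w3
  have f8 : ⁅e ^ (3 ^ 10), ⁅b, a⁆⁆ ∈ A 7 := by
    have e1 : e ^ (3 ^ 10) = (a ^ (3 ^ 12))⁻¹ * q ^ (3 ^ 8) := by rw [← h2, inv_mul_cancel_left]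
    rw [e1]
    apply commute_mk
    rw [map_mul, map_inv]
    exact (mk_commute f7).inv_left.mul_left (mk_commute f3)
  have m1 : ⁅e, ⁅b, a⁆⁆ ∈ A 4 := hA.comm he w1
  have m2 : ⁅e, ⁅e, ⁅b, a⁆⁆⁆ ∈ A 6 := hA.comm he m1
  have m3 : ⁅e, ⁅e, ⁅e, ⁅b, a⁆⁆⁆⁆ ∈ A 8 := hA.comm he m2
  have m4 : ⁅e, ⁅e, ⁅e, ⁅e, ⁅b, a⁆⁆⁆⁆⁆ ∈ A 10 := hA.comm he m3
  have t1 : ⁅e, ⁅b, a⁆⁆ ^ 9 ∈ A 5 := hA.q2 5 he w1 w2 (by omega) (by omega)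
  have t2 : ⁅e, ⁅e, ⁅b, a⁆⁆⁆ ^ 9 ∈ A 7 := hA.q2 7 he m1 t1 (by omega) (by omega)
  have hd : 9 ∣ (3 ^ 10).choose 2 * 1 := by
    rw [mul_one]
    exact (Dvd.intro (3 ^ 7) (by norm_num) : 9 ∣ 3 ^ 9).trans (choose_dvd 9 2 (by omega))
  have f9 := (hA.tt 7 (k := 3 ^ 10) (m := 1) he w1 (by omega) (by omega)
    (pow_dvd_mem t2 hd) (Subgroup.pow_mem _ (hA.anti (by omega) m3) _)
    (Subgroup.pow_mem _ (hA.anti (by omega) m4) _)).1 (by rw [pow_one]; exact f8)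
  rw [mul_one] at f9
  have e1 : ⁅⁅a, b⁆, e⁆ = ⁅b, a⁆⁻¹ * ⁅e, ⁅b, a⁆⁆ * ⁅b, a⁆⁻¹⁻¹ := by
    simp only [commutatorElement_def]; group
  rw [e1, conj_pow]
  exact this.conj_mem _ f9 _

end Mem

section Final

/-- the projection from the free group -/
def tpr : FreeGroup TGen →* TGrp := PresentedGroup.mk tRels

theorem tpr_rel (w : FreeGroup TGen) (h : w ∈ tRels) : tpr w = 1 :=
  PresentedGroup.one_of_mem h

theorem tpr_e (i : Fin 4) : tpr (eF i) = eT i := rfl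

theorem omega_mem : ((⁅⁅eT 2, eT 1⁆, eT 0⁆ ^ (3 ^ 9)) ^ 3) ∈ gammaGrp TGrp 7 := by
  have hA := filt_gamma TGrp
  have hy : ∀ i, tpr (yF i) ∈ gammaGrp TGrp 2 := fun i => by
    rw [yF, map_commutatorElement]; exact hA.comm (hA.top _) (hA.top _)
  have hyy : ∀ k, tpr (yyF k) ∈ gammaGrp TGrp 3 := fun k => by
    rw [yyF, map_commutatorElement, map_commutatorElement]
    exact hA.comm (hA.comm (hA.top _) (hA.top _)) (hA.top _)
  have hr1 : ∀ i : Fin 4, eT i ^ (3 ^ (2 * (i : ℕ))) ∈ gammaGrp TGrp 2 := fun i => by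
    have h := tpr_rel _ (Or.inl ⟨i, rfl⟩)
    rw [map_mul, map_inv, mul_inv_eq_one, map_pow, tpr_e] at h
    rw [h]; exact hy i
  have hr2 : ∀ k : Fin 4, eT (pairIdx k).2 ^ (3 ^ (12 - ((pairIdx k).1 : ℕ)))
      * eT (pairIdx k).1 ^ (3 ^ (12 - ((pairIdx k).2 : ℕ))) =
      tpr (yyF k) ^ (3 ^ (12 - 2 * ((pairIdx k).1 : ℕ) - 2 * ((pairIdx k).2 : ℕ))) := fun k => by
    have h := tpr_rel _ (Or.inr ⟨k, rfl⟩)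
    rw [map_mul, map_inv, mul_inv_eq_one, map_mul, map_pow, map_pow, map_pow, tpr_e, tpr_e] at h
    exact h
  have h0 : eT 0 ∈ gammaGrp TGrp 2 := by have := hr1 0; simpa using this
  have h1 : eT 1 ^ 9 ∈ gammaGrp TGrp 2 := hr1 1
  have h2 : eT 2 ^ 81 ∈ gammaGrp TGrp 2 := hr1 2
  have e01 := hr2 0
  have e02 := hr2 1
  have key := hA.s8 h2 h1 h0 (hyy 0) (hyy 1) e01 e02
  rw [← pow_mul, ← pow_succ]
  exact key

end Final


/-- The element `ω = [[e_2, e_1], e_0]^{3⁹}` does not lie in `γ_7(G)`, but its cube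
`ω³` does lie in `γ_7(G)`. -/
theorem three_torsion_group_example_gamma :
    (⁅⁅eT 2, eT 1⁆, eT 0⁆ ^ (3 ^ 9)) ∉ gammaGrp TGrp 7 ∧
    ((⁅⁅eT 2, eT 1⁆, eT 0⁆ ^ (3 ^ 9)) ^ 3) ∈ gammaGrp TGrp 7 := by
  exact ⟨omega_not_mem, omega_mem⟩
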